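/- Let $(M,g)$ be a smooth Riemannian manifold of dimension $n\ge 3$, with Levi-Civita connection $\nabla$ and curvature tensor $R(X,Y)Z=\nabla_X\nabla_YZ-\nabla_Y\nabla_XZ-\nabla_{[X,Y]}Z$; let $(\nabla_WR)$ denote the covariant derivative of $R$. For a vector field $X$ on $M$ let $X^h$ and $X^v$ be its horizontal lift (with respect to $\nabla$) and its vertical lift to the tangent bundle $TM$; in induced coordinates $(x^i,y^i)$ they are $X^h=X^i\left(\frac{\partial}{\partial x^i}-y^a\Gamma^j_{ai}\frac{\partial}{\partial y^j}\right)$ and $X^v=X^i\frac{\partial}{\partial y^i}$; tangent vectors of $M$ at $x$ are lifted to $T_{(x,y)}TM$ by the same formulas. Let $a,b,c$ be real constants with $a>0$ and $\alpha:=a(a+c)-b^2>0$, and let $G=a g^s+b g^h+c g^v$ be the Riemannian metric on $TM$ given by $$G(X^h,Y^h)=(a+c)\,g(X,Y),\quad G(X^h,Y^v)=G(X^v,Y^h)=b\,g(X,Y),\quad G(X^v,Y^v)=a\,g(X,Y).$$ Let $\widetilde R$ be the curvature tensor of $(TM,G)$, with the same sign convention. Then for all smooth vector fields $X,Y,Z$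 on $M$ and every point $(x,y)\in TM$, writing $t$ for the vector $y\in T_xM$, one has at $(x,y)$ $$\begin{aligned} \widetilde R(X^h,Y^h)Z^v={}&\Big\{\tfrac{a^2}{2\alpha}\big[(\nabla_YR)(Z,t)X-(\nabla_XR)(Z,t)Y\big]+\tfrac{a^3b}{4\alpha^2}\big[R(X,t)R(Z,t)Y-R(Y,t)R(Z,t)X\big]\Big\}^h\\ &+\Big\{R(X,Y)Z+\tfrac{ab}{2\alpha}\big[(\nabla_XR)(Z,t)Y-(\nabla_YR)(Z,t)X\big]+\tfrac{a^2}{4\alpha}\big[R(X,R(Z,t)Y)t-R(Y,R(Z,t)X)t\big]\\ &\qquad+\tfrac{a^2b^2}{4\alpha^2}\big[R(Y,t)R(Z,t)X-R(X,t)R(Z,t)Y\big]\Big\}^v . \end{aligned}$$ -/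

import Mathlib

open Bundle VectorField
open scoped Manifold ContDiff

noncomputable section

namespace GNat

section Riemannian

variable {E : Type*} [NormedAddCommGroup E] [NormedSpace ℝ E]
  {H : Type*} [TopologicalSpace H] {I : ModelWithCorners ℝ E H}
  {N : Type*} [TopologicalSpace N] [ChartedSpace H N]

/-- Not necessarily continuous vector fields on `N`. -/
abbrev VField (I : ModelWithCorners ℝ E H) (N : Type*) [TopologicalSpace N] [ChartedSpace H N] :=
  Π x : N, TangentSpace I x

/-- A field of real-valued functions of two tangent vectors; a Riemannian metric is one of these. -/
abbrev MetricField (I : ModelWithCorners ℝ E H) (N : Type*) [TopologicalSpace N]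
    [ChartedSpace H N] :=
  Π x : N, TangentSpace I x → TangentSpace I x → ℝ

/-- The derivative `X f` of the function `f` along the vector field `X`, at `x`. -/
def dirDeriv (X : VField I N) (f : N → ℝ) (x : N) : ℝ :=
  (mfderiv I 𝓘(ℝ, ℝ) f x : TangentSpace I x → ℝ) (X x)

/-- The right-hand side of the Koszul formula,
`X g(Y,Z) + Y g(X,Z) - Z g(X,Y) + g([X,Y],Z) - g([X,Z],Y) - g([Y,Z],X)`, at `x`. -/
def koszul (g : MetricField I N) (X Y Z : VField I N) (x : N) : ℝ :=
  dirDeriv X (fun z ↦ g z (Y z) (Z z)) x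
    + dirDeriv Y (fun z ↦ g z (X z) (Z z)) x
    - dirDeriv Z (fun z ↦ g z (X z) (Y z)) x
    + g x (mlieBracket I X Y x) (Z x)
    - g x (mlieBracket I X Z x) (Y x)
    - g x (mlieBracket I Y Z x) (X x)

variable [IsManifold I 1 N]

/-- `X` is a smooth vector field near `x`. -/
def SmoothAt (X : VField I N) (x : N) : Prop :=
  ContMDiffAt I I.tangent ∞ (fun z ↦ (⟨z, X z⟩ : TangentBundle I N)) x

/-- `X` is a smooth vector field on `N`. -/
def Smooth (X : VField I N) : Prop :=
  ContMDiff I I.tangent ∞ (fun z ↦ (⟨z, X z⟩ : TangentBundle I N))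

/-- `g` is a smooth Riemannian metric on `N`. -/
def IsRiemannianMetric (g : MetricField I N) : Prop :=
  ∃ g' : ContMDiffRiemannianMetric I ∞ E (fun x : N ↦ TangentSpace I x),
    ∀ (x : N) (u v : TangentSpace I x), g x u v = g'.inner x u v

open Classical in
/-- The Levi-Civita connection `∇_X Y` of the metric `g`, defined by the Koszul formula: at `x` it
is the tangent vector `v` with `2 g(v, Z) = koszul g X Y Z` for all vector fields `Z` that are
smooth near `x`. (For a Riemannian metric and smooth `X`, `Y` there is exactly one such `v`.) -/
def leviCivita (g : MetricField I N) (X Y : VField I N) : VField I N := fun x ↦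
  if h : ∃ v : TangentSpace I x, ∀ Z : VField I N, SmoothAt Z x →
      2 * g x v (Z x) = koszul g X Y Z x
  then h.choose else 0

/-- `R(X,Y)Z = ∇_X ∇_Y Z - ∇_Y ∇_X Z - ∇_[X,Y] Z`. -/
def curvature (g : MetricField I N) (X Y Z : VField I N) : VField I N :=
  leviCivita g X (leviCivita g Y Z) - leviCivita g Y (leviCivita g X Z)
    - leviCivita g (mlieBracket I X Y) Z

/-- `(∇_W R)(X,Y)Z = ∇_W (R(X,Y)Z) - R(∇_W X,Y)Z - R(X,∇_W Y)Z - R(X,Y)∇_W Z`. -/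
def covDerivCurvature (g : MetricField I N) (W X Y Z : VField I N) : VField I N :=
  leviCivita g W (curvature g X Y Z) - curvature g (leviCivita g W X) Y Z
    - curvature g X (leviCivita g W Y) Z - curvature g X Y (leviCivita g W Z)

/-- A vector field, smooth near `x`, that takes the value `v` at `x`. -/
def extField {x : N} (v : TangentSpace I x) : VField I N :=
  FiberBundle.extend E v

/-- The value `R(u,v)w` of the tensor `R` on tangent vectors at `x`. -/
def curvatureAt (g : MetricField I N) {x : N} (u v w : TangentSpace I x) : TangentSpace I x :=
  curvature g (extField u) (extField v) (extField w) x

/-- The value `(∇_s R)(u,v)w` of the tensor `∇R` on tangent vectors at `x`. -/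
def covDerivCurvatureAt (g : MetricField I N) {x : N} (s u v w : TangentSpace I x) :
    TangentSpace I x :=
  covDerivCurvature g (extField s) (extField u) (extField v) (extField w) x

end Riemannian

section TangentBundle

variable {E : Type*} [NormedAddCommGroup E] [NormedSpace ℝ E]
  {H : Type*} [TopologicalSpace H] {I : ModelWithCorners ℝ E H}
  {M : Type*} [TopologicalSpace M] [ChartedSpace H M] [IsManifold I 1 M]

/-- The vertical lift to `T_p TM` of a vector `v` tangent to `M` at the base point `x` of
`p = (x,y)`: the image of `v` under the derivative at `y` of the inclusion `w ↦ (x,w)` of the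
fibre. In induced coordinates it is `vⁱ ∂/∂yⁱ`. -/
def verLiftAt (p : TangentBundle I M) (v : TangentSpace I p.proj) : TangentSpace I.tangent p :=
  (mfderiv 𝓘(ℝ, E) I.tangent (fun w : E ↦ (⟨p.proj, w⟩ : TangentBundle I M)) p.snd :
    E → TangentSpace I.tangent p) v

/-- The horizontal lift to `T_p TM` of a vector `v` tangent to `M` at the base point `x` of
`p = (x,y)`, for the Levi-Civita connection of `g`: it is `dσ(v) - (∇_v σ)ᵛ` for a smooth local
section `σ` of `TM` with `σ(x) = y`. In induced coordinates it is `vⁱ (∂/∂xⁱ - yᵃ Γʲₐᵢ ∂/∂yʲ)`. -/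
def horLiftAt (g : MetricField I M) (p : TangentBundle I M) (v : TangentSpace I p.proj) :
    TangentSpace I.tangent p :=
  let dσv : TangentSpace I.tangent p :=
    mfderiv I I.tangent (fun z ↦ (⟨z, extField p.snd z⟩ : TangentBundle I M)) p.proj v
  dσv - verLiftAt p (leviCivita g (extField v) (extField p.snd) p.proj)

/-- The vertical lift `Xᵛ`. -/
def verLift (X : VField I M) : VField I.tangent (TangentBundle I M) :=
  fun p ↦ verLiftAt p (X p.proj)

/-- The horizontal lift `Xʰ`. -/
def horLift (g : MetricField I M) (X : VField I M) : VField I.tangent (TangentBundle I M) :=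
  fun p ↦ horLiftAt g p (X p.proj)

/-- The vector `u` tangent to `M` for which `ξ = uʰ + wᵛ`: the image of `ξ` under the derivative
of the bundle projection. -/
def horPart (p : TangentBundle I M) (ξ : TangentSpace I.tangent p) : TangentSpace I p.proj :=
  mfderiv I.tangent I (fun q : TangentBundle I M ↦ q.proj) p ξ

/-- The vector `w` tangent to `M` for which `ξ = uʰ + wᵛ`. -/
def verPart (g : MetricField I M) (p : TangentBundle I M) (ξ : TangentSpace I.tangent p) :
    TangentSpace I p.proj :=
  Function.invFun (verLiftAt p) (ξ - horLiftAt g p (horPart p ξ))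

/-- The metric `gˢ` on `TM`. -/
def sasakiLift (g : MetricField I M) : MetricField I.tangent (TangentBundle I M) :=
  fun p ξ η ↦ g p.proj (horPart p ξ) (horPart p η) + g p.proj (verPart g p ξ) (verPart g p η)

/-- The lift `gʰ` to `TM`. -/
def horizontalLift (g : MetricField I M) : MetricField I.tangent (TangentBundle I M) :=
  fun p ξ η ↦ g p.proj (horPart p ξ) (verPart g p η) + g p.proj (verPart g p ξ) (horPart p η)

/-- The lift `gᵛ` to `TM`. -/
def verticalLift (g : MetricField I M) : MetricField I.tangent (TangentBundle I M) :=
  fun p ξ η ↦ g p.proj (horPart p ξ) (horPart p η)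

/-- The metric `G = a gˢ + b gʰ + c gᵛ` on `TM`. -/
def gNatural (g : MetricField I M) (a b c : ℝ) : MetricField I.tangent (TangentBundle I M) :=
  fun p ξ η ↦ a * sasakiLift g p ξ η + b * horizontalLift g p ξ η + c * verticalLift g p ξ η

end TangentBundle

end GNat

end

noncomputable section

open Filter Topology

set_option linter.unusedSectionVars false

namespace GNat

section Basics

variable {E : Type*} [NormedAddCommGroup E] [NormedSpace ℝ E]
  {H : Type*} [TopologicalSpace H] {I : ModelWithCorners ℝ E H}
  {N : Type*} [TopologicalSpace N] [ChartedSpace H N]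

/-- `f` is a smooth function near `x`, in the pointwise sense of `ContMDiffAt`. -/
abbrev SmoothFunAt (I : ModelWithCorners ℝ E H) (f : N → ℝ) (x : N) : Prop :=
  ContMDiffAt I 𝓘(ℝ, ℝ) ∞ f x

/-- `f` is smooth at all points of a neighbourhood of `x`. -/
def SmoothFunNear (I : ModelWithCorners ℝ E H) (f : N → ℝ) (x : N) : Prop :=
  ∀ᶠ z in 𝓝 x, SmoothFunAt I f z

lemma SmoothFunAt.mdiff {f : N → ℝ} {x : N} (hf : SmoothFunAt I f x) :
    MDifferentiableAt I 𝓘(ℝ, ℝ) f x :=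
  ContMDiffAt.mdifferentiableAt hf (by simp)

lemma dirDeriv_congr {X : VField I N} {f f' : N → ℝ} {x : N} (h : f =ᶠ[𝓝 x] f') :
    dirDeriv X f x = dirDeriv X f' x := by
  exact congrArg (fun L : TangentSpace I x →L[ℝ] ℝ ↦ L (X x)) h.mfderiv_eq

lemma dirDeriv_congr_left {X X' : VField I N} {f : N → ℝ} {x : N} (h : X x = X' x) :
    dirDeriv X f x = dirDeriv X' f x := by
  unfold dirDeriv; rw [h]

lemma dirDeriv_add_left (X Y : VField I N) (f : N → ℝ) (x : N) :
    dirDeriv (X + Y) f x = dirDeriv X f x + dirDeriv Y f x :=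
  map_add (mfderiv I 𝓘(ℝ, ℝ) f x) (X x) (Y x)

lemma dirDeriv_smul_left (h : N → ℝ) (X : VField I N) (f : N → ℝ) (x : N) :
    dirDeriv (h • X) f x = h x * dirDeriv X f x :=
  map_smul (mfderiv I 𝓘(ℝ, ℝ) f x) (h x) (X x)

lemma dirDeriv_add (X : VField I N) {f h : N → ℝ} {x : N} (hf : SmoothFunAt I f x)
    (hh : SmoothFunAt I h x) :
    dirDeriv X (fun z ↦ f z + h z) x = dirDeriv X f x + dirDeriv X h x := by
  have := (hf.mdiff.hasMFDerivAt.add hh.mdiff.hasMFDerivAt).mfderiv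
  unfold dirDeriv
  exact congrArg (fun L ↦ L (X x)) this

lemma dirDeriv_mul (X : VField I N) {f h : N → ℝ} {x : N} (hf : SmoothFunAt I f x)
    (hh : SmoothFunAt I h x) :
    dirDeriv X (fun z ↦ f z * h z) x = f x * dirDeriv X h x + h x * dirDeriv X f x := by
  have := (hf.mdiff.hasMFDerivAt.mul hh.mdiff.hasMFDerivAt).mfderiv
  unfold dirDeriv
  exact congrArg (fun L ↦ L (X x)) this

lemma dirDeriv_const (X : VField I N) (r : ℝ) (x : N) :
    dirDeriv X (fun _ ↦ r) x = 0 := by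
  unfold dirDeriv
  rw [mfderiv_const]; rfl

lemma dirDeriv_const_mul (X : VField I N) (r : ℝ) {f : N → ℝ} {x : N} (hf : SmoothFunAt I f x) :
    dirDeriv X (fun z ↦ r * f z) x = r * dirDeriv X f x := by
  rw [dirDeriv_mul X contMDiffAt_const hf, dirDeriv_const]; ring

/-- The vector fields `X` and `Y` agree near `x`. -/
def GermEq (X Y : VField I N) (x : N) : Prop := ∀ᶠ z in 𝓝 x, X z = Y z

lemma GermEq.refl (X : VField I N) (x : N) : GermEq X X x := Eventually.of_forall fun _ ↦ rfl

lemma GermEq.symm {X Y : VField I N} {x : N} (h : GermEq X Y x) : GermEq Y X x :=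
  Eventually.mono h fun _ hz ↦ hz.symm

lemma GermEq.eventually {X Y : VField I N} {x : N} (h : GermEq X Y x) :
    ∀ᶠ z in 𝓝 x, GermEq X Y z := eventually_eventually_nhds.2 h

lemma GermEq.eq {X Y : VField I N} {x : N} (h : GermEq X Y x) : X x = Y x :=
  Eventually.self_of_nhds (p := fun z ↦ X z = Y z) h

lemma GermEq.mlieBracket {X X' Y Y' : VField I N} {x : N} (hX : GermEq X X' x)
    (hY : GermEq Y Y' x) : mlieBracket I X Y x = mlieBracket I X' Y' x :=
  EventuallyEq.mlieBracket_vectorField_eq hX hY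

variable [IsManifold I ∞ N]

/-- `X` is smooth at all points of a neighbourhood of `x`. -/
def SmoothNear (X : VField I N) (x : N) : Prop := ∀ᶠ z in 𝓝 x, SmoothAt X z

lemma SmoothNear.smoothAt {X : VField I N} {x : N} (h : SmoothNear X x) : SmoothAt X x :=
  h.self_of_nhds

lemma SmoothNear.eventually {X : VField I N} {x : N} (h : SmoothNear X x) :
    ∀ᶠ z in 𝓝 x, SmoothNear X z := eventually_eventually_nhds.2 h

lemma Smooth.smoothNear {X : VField I N} (h : Smooth X) (x : N) : SmoothNear X x :=
  Eventually.of_forall fun z ↦ h z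

lemma SmoothAt.mdiff {X : VField I N} {x : N} (h : SmoothAt X x) :
    MDifferentiableAt I I.tangent (fun z ↦ (⟨z, X z⟩ : TangentBundle I N)) x :=
  ContMDiffAt.mdifferentiableAt h (by simp)

lemma SmoothAt.congr {X Y : VField I N} {x : N} (h : SmoothAt X x) (hXY : GermEq X Y x) :
    SmoothAt Y x :=
  ContMDiffAt.congr_of_eventuallyEq h (hXY.symm.mono fun z hz ↦ by simp [hz])

lemma SmoothNear.congr {X Y : VField I N} {x : N} (h : SmoothNear X x) (hXY : GermEq X Y x) :
    SmoothNear Y x := by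
  filter_upwards [h, hXY.eventually] with z hz hz' using hz.congr hz'

lemma SmoothAt.add {X Y : VField I N} {x : N} (hX : SmoothAt X x) (hY : SmoothAt Y x) :
    SmoothAt (X + Y) x := ContMDiffAt.add_section hX hY

lemma SmoothAt.sub {X Y : VField I N} {x : N} (hX : SmoothAt X x) (hY : SmoothAt Y x) :
    SmoothAt (X - Y) x := ContMDiffAt.sub_section hX hY

lemma SmoothAt.smul {f : N → ℝ} {X : VField I N} {x : N} (hf : SmoothFunAt I f x)
    (hX : SmoothAt X x) : SmoothAt (f • X) x := ContMDiffAt.smul_section hf hX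

lemma SmoothAt.const_smul (r : ℝ) {X : VField I N} {x : N}
    (hX : SmoothAt X x) : SmoothAt (r • X) x := ContMDiffAt.const_smul_section hX

lemma SmoothAt.sum {ι : Type*} {s : Finset ι} {X : ι → VField I N} {x : N}
    (hX : ∀ i ∈ s, SmoothAt (X i) x) : SmoothAt (∑ i ∈ s, X i) x := by
  have h : SmoothAt (fun z ↦ ∑ i ∈ s, X i z : VField I N) x := ContMDiffAt.sum_section hX
  exact h.congr (Eventually.of_forall fun z ↦ (Finset.sum_apply z s X).symm)

lemma SmoothNear.add {X Y : VField I N} {x : N} (hX : SmoothNear X x) (hY : SmoothNear Y x) :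
    SmoothNear (X + Y) x := by
  filter_upwards [hX, hY] with z h h' using h.add h'

lemma SmoothNear.sub {X Y : VField I N} {x : N} (hX : SmoothNear X x) (hY : SmoothNear Y x) :
    SmoothNear (X - Y) x := by
  filter_upwards [hX, hY] with z h h' using h.sub h'

lemma SmoothNear.smul {f : N → ℝ} {X : VField I N} {x : N} (hf : SmoothFunNear I f x)
    (hX : SmoothNear X x) : SmoothNear (f • X) x := by
  filter_upwards [hf, hX] with z h h' using SmoothAt.smul h h'

lemma SmoothNear.sum {ι : Type*} {s : Finset ι} {X : ι → VField I N} {x : N}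
    (hX : ∀ i ∈ s, SmoothNear (X i) x) : SmoothNear (∑ i ∈ s, X i) x := by
  filter_upwards [(eventually_all_finset s).2 hX] with z h using SmoothAt.sum h

lemma SmoothAt.mlieBracket [CompleteSpace E] {X Y : VField I N} {x : N} (hX : SmoothAt X x)
    (hY : SmoothAt Y x) : SmoothAt (mlieBracket I X Y) x := by
  have : IsManifold I (((⊤ : ℕ∞) : WithTop ℕ∞) + 1) N := ‹IsManifold I ∞ N›
  have : IsManifold I (minSmoothness ℝ 2) N := by
    simpa using (inferInstance : IsManifold I 2 N)
  exact ContMDiffAt.mlieBracket_vectorField (n := ⊤) (m := ⊤) hX hY (by simp)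

lemma SmoothNear.mlieBracket [CompleteSpace E] {X Y : VField I N} {x : N} (hX : SmoothNear X x)
    (hY : SmoothNear Y x) : SmoothNear (mlieBracket I X Y) x := by
  filter_upwards [hX, hY] with z h h' using h.mlieBracket h'

lemma extField_self {x : N} (v : TangentSpace I x) : extField v x = v :=
  FiberBundle.extend_apply_self _ v

lemma extField_smoothNear {x : N} (v : TangentSpace I x) : SmoothNear (extField v) x := by
  set e := trivializationAt E (TangentSpace I : N → Type _) x
  have : ∀ z ∈ e.baseSet, SmoothAt (extField v) z := by
    intro z hz
    refine (e.contMDiffAt_section_iff hz).2 ?_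
    refine (contMDiffAt_const (c := (e ⟨x, v⟩).2)).congr_of_eventuallyEq ?_
    filter_upwards [e.open_baseSet.mem_nhds hz] with y hy
    exact (congrArg Prod.snd (e.apply_mk_symm hy (e ⟨x, v⟩).2) : _)
  exact eventually_of_mem
    (e.open_baseSet.mem_nhds (FiberBundle.mem_baseSet_trivializationAt' x)) this

/-! ### Local frames -/

/-- The domain of `frame x`. -/
def frameSet (I : ModelWithCorners ℝ E H) [IsManifold I ∞ N] (x : N) : Set N :=
  (trivializationAt E (TangentSpace I : N → Type _) x).baseSet

lemma frameSet_mem_nhds (x : N) : frameSet I x ∈ 𝓝 x :=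
  (trivializationAt E (TangentSpace I : N → Type _) x).open_baseSet.mem_nhds
    (FiberBundle.mem_baseSet_trivializationAt' x)

lemma mem_frameSet (x : N) : x ∈ frameSet I x := mem_of_mem_nhds (frameSet_mem_nhds x)

lemma isOpen_frameSet (x : N) : IsOpen (frameSet I x) :=
  (trivializationAt E (TangentSpace I : N → Type _) x).open_baseSet

variable [FiniteDimensional ℝ E]

/-- The index type of the local frames. -/
abbrev FIdx (E : Type*) [NormedAddCommGroup E] [NormedSpace ℝ E] := Fin (Module.finrank ℝ E)

/-- The local frame around `x` given by the preferred trivialization. -/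
def frame (I : ModelWithCorners ℝ E H) [IsManifold I ∞ N] (x : N) (i : FIdx E) : VField I N :=
  (trivializationAt E (TangentSpace I : N → Type _) x).localFrame (Module.finBasis ℝ E) i

/-- The dual coframe of `frame`. -/
def coframe (I : ModelWithCorners ℝ E H) [IsManifold I ∞ N] (x : N) (i : FIdx E) (z : N) :
    TangentSpace I z →ₗ[ℝ] ℝ :=
  (trivializationAt E (TangentSpace I : N → Type _) x).localFrameCoeff I (Module.finBasis ℝ E) i z

lemma frame_smoothAt {x z : N} (hz : z ∈ frameSet I x) (i : FIdx E) :
    SmoothAt (frame I x i) z :=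
  contMDiffAt_localFrame_of_mem ∞ _ _ i hz

lemma frame_smoothNear (x : N) (i : FIdx E) : SmoothNear (frame I x i) x :=
  eventually_of_mem (frameSet_mem_nhds x) fun _ hz ↦ frame_smoothAt hz i

lemma coframe_smoothAt {x z : N} (hz : z ∈ frameSet I x) (i : FIdx E) {X : VField I N}
    (hX : SmoothAt X z) : SmoothFunAt I (fun y ↦ coframe I x i y (X y)) z :=
  contMDiffAt_localFrameCoeff (Module.finBasis ℝ E) hz hX i

lemma sum_coframe_smul_frame {x z : N} (hz : z ∈ frameSet I x) (v : TangentSpace I z) :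
    ∑ i, coframe I x i z v • frame I x i z = v := by
  have := (trivializationAt E (TangentSpace I : N → Type _) x).eq_sum_localFrameCoeff_smul
    (I := I) (b := Module.finBasis ℝ E) (s := extField v) hz
  rw [extField_self] at this
  exact this.symm

lemma coframe_eq_repr {x z : N} (hz : z ∈ frameSet I x) (i : FIdx E) (v : TangentSpace I z) :
    coframe I x i z v = (Module.finBasis ℝ E).repr
      ((trivializationAt E (TangentSpace I : N → Type _) x) ⟨z, v⟩).2 i := by
  have := (trivializationAt E (TangentSpace I : N → Type _) x).localFrameCoeff_eq_coeff
    (I := I) (b := Module.finBasis ℝ E) (s := extField v) hz (i := i)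
  simp only [extField_self] at this
  exact this

lemma smoothAt_of_coframe {x : N} {X : VField I N}
    (h : ∀ i, SmoothFunAt I (fun y ↦ coframe I x i y (X y)) x) : SmoothAt X x :=
  (contMDiffAt_iff_localFrameCoeff (Module.finBasis ℝ E) (mem_frameSet x)).2 h

/-! ### Directional derivatives and smoothness -/

lemma SmoothFunAt.dirDeriv {X : VField I N} {f : N → ℝ} {x : N} (hX : SmoothAt X x)
    (hf : SmoothFunAt I f x) : SmoothFunAt I (dirDeriv X f) x := by
  have h1 := ContMDiffAt.mfderiv_const (m := ∞) hf (by simp)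
  have h2 : ContMDiffAt I 𝓘(ℝ, E) ∞
      (fun z ↦ ((trivializationAt E (TangentSpace I : N → Type _) x) ⟨z, X z⟩).2) x :=
    ((trivializationAt E (TangentSpace I : N → Type _) x).contMDiffAt_section_iff
      (mem_frameSet x)).1 hX
  refine (h1.clm_apply h2).congr_of_eventuallyEq ?_
  filter_upwards [frameSet_mem_nhds (I := I) x] with z hz
  have h3 : (trivializationAt E (TangentSpace I : N → Type _) x).symmL ℝ z
      ((trivializationAt E (TangentSpace I : N → Type _) x) ⟨z, X z⟩).2 = X z := by
    rw [Trivialization.symmL_apply _ hz]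
    exact (trivializationAt E (TangentSpace I : N → Type _) x).symm_apply_apply_mk hz (X z)
  have h4 (r : ℝ) : (trivializationAt ℝ (TangentSpace 𝓘(ℝ, ℝ)) (f x)).continuousLinearMapAt ℝ
      (f z) r = r := by
    rw [TangentBundle.continuousLinearMapAt_model_space]; rfl
  change _ = (trivializationAt ℝ (TangentSpace 𝓘(ℝ, ℝ)) (f x)).continuousLinearMapAt ℝ (f z)
    (mfderiv I 𝓘(ℝ, ℝ) f z ((trivializationAt E (TangentSpace I : N → Type _) x).symmL ℝ z
      ((trivializationAt E (TangentSpace I : N → Type _) x) ⟨z, X z⟩).2))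
  rw [h3]
  exact (h4 _).symm

lemma SmoothFunNear.dirDeriv {X : VField I N} {f : N → ℝ} {x : N} (hX : SmoothNear X x)
    (hf : SmoothFunNear I f x) : SmoothFunNear I (dirDeriv X f) x := by
  filter_upwards [hX, hf] with z h h' using SmoothFunAt.dirDeriv h h'

lemma trivializationAt_snd_eq_mfderiv {x z : N} (hz : z ∈ frameSet I x) (v : TangentSpace I z) :
    ((trivializationAt E (TangentSpace I : N → Type _) x) ⟨z, v⟩).2
      = mfderiv I 𝓘(ℝ, E) (extChartAt I x) z v := by
  rw [← TangentBundle.continuousLinearMapAt_trivializationAt hz]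
  exact (Trivialization.continuousLinearMapAt_apply_of_mem ℝ
    (trivializationAt E (TangentSpace I : N → Type _) x) hz v).symm

lemma mfderiv_clm_comp_extChartAt {x z : N} (hz : z ∈ frameSet I x) (L : E →L[ℝ] ℝ)
    (v : TangentSpace I z) :
    (mfderiv I 𝓘(ℝ, ℝ) (fun y ↦ L (extChartAt I x y)) z : TangentSpace I z → ℝ) v
      = L (((trivializationAt E (TangentSpace I : N → Type _) x) ⟨z, v⟩).2) := by
  rw [trivializationAt_snd_eq_mfderiv hz]
  have h1 : MDifferentiableAt I 𝓘(ℝ, E) (extChartAt I x) z := mdifferentiableAt_extChartAt hz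
  have h2 := (L.hasMFDerivAt (x := extChartAt I x z)).comp z h1.hasMFDerivAt
  exact congrArg (fun T : TangentSpace I z →L[ℝ] ℝ ↦ T v) h2.mfderiv

/-- Smoothness of a vector field can be tested on the coordinate functions of one chart. -/
lemma smoothAt_of_dirDeriv {x : N} {X : VField I N}
    (h : ∀ L : E →L[ℝ] ℝ, SmoothFunAt I (dirDeriv X (fun z ↦ L (extChartAt I x z))) x) :
    SmoothAt X x := by
  refine smoothAt_of_coframe fun i ↦ ?_
  refine (h ((Module.finBasis ℝ E).coord i).toContinuousLinearMap).congr_of_eventuallyEq ?_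
  filter_upwards [frameSet_mem_nhds (I := I) x] with z hz
  rw [coframe_eq_repr hz]
  exact (mfderiv_clm_comp_extChartAt hz
    ((Module.finBasis ℝ E).coord i).toContinuousLinearMap (X z)).symm

/-- Tangent vectors are separated by the coordinate functions of a chart. -/
lemma eq_of_mfderiv_coord_eq {x z : N} (hz : z ∈ frameSet I x) {u v : TangentSpace I z}
    (h : ∀ L : E →L[ℝ] ℝ,
      (mfderiv I 𝓘(ℝ, ℝ) (fun z ↦ L (extChartAt I x z)) z : TangentSpace I z → ℝ) u
      = (mfderiv I 𝓘(ℝ, ℝ) (fun z ↦ L (extChartAt I x z)) z : TangentSpace I z → ℝ) v) :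
    u = v := by
  rw [← sum_coframe_smul_frame hz u, ← sum_coframe_smul_frame hz v]
  refine Finset.sum_congr rfl fun i _ ↦ ?_
  have := h ((Module.finBasis ℝ E).coord i).toContinuousLinearMap
  rw [mfderiv_clm_comp_extChartAt hz, mfderiv_clm_comp_extChartAt hz] at this
  rw [coframe_eq_repr hz, coframe_eq_repr hz]
  exact congrArg (· • frame I x i z) this

/-! ### Tensoriality -/

/-- `Φ` is additive and `C^∞`-linear on the vector fields that are smooth along the filter `l`. -/
structure SmoothTensorial {A : Type*} [AddCommGroup A] [Module ℝ A] (l : Filter N) (x : N)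
    (Φ : VField I N → A) : Prop where
  add : ∀ {X Y : VField I N}, (∀ᶠ z in l, SmoothAt X z) → (∀ᶠ z in l, SmoothAt Y z) →
    Φ (X + Y) = Φ X + Φ Y
  smul : ∀ {f : N → ℝ} {X : VField I N}, (∀ᶠ z in l, SmoothFunAt I f z) →
    (∀ᶠ z in l, SmoothAt X z) → Φ (f • X) = f x • Φ X

namespace SmoothTensorial

variable {A : Type*} [AddCommGroup A] [Module ℝ A] {l : Filter N} {x : N} {Φ : VField I N → A}

lemma congr (hΦ : SmoothTensorial l x Φ) (hl : l ≤ 𝓝 x) {X Y : VField I N}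
    (hX : ∀ᶠ z in l, SmoothAt X z) (hXY : GermEq X Y x) : Φ X = Φ Y := by
  classical
  let ψ (z : N) : ℝ := if X z = Y z then 1 else 0
  have hψx : ψ x = 1 := by simp [ψ, hXY.eq]
  have hψ : ∀ᶠ z in l, SmoothFunAt I ψ z := by
    refine hl ?_
    filter_upwards [hXY.eventually] with z hz
    exact (contMDiffAt_const (c := (1 : ℝ))).congr_of_eventuallyEq
      (hz.mono fun y hy ↦ by simp [ψ, hy])
  have hY : ∀ᶠ z in l, SmoothAt Y z := by
    filter_upwards [hX, hl hXY.eventually] with z hz hz' using hz.congr hz'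
  have key : ψ • X = ψ • Y := by
    ext1 z
    by_cases h : X z = Y z <;> simp [ψ, h]
  have h1 := hΦ.smul hψ hX
  have h2 := hΦ.smul hψ hY
  rw [hψx, one_smul] at h1 h2
  rw [← h1, ← h2, key]

lemma zero (hΦ : SmoothTensorial l x Φ) : Φ 0 = 0 := by
  have h0 : ∀ᶠ z in l, SmoothAt (0 : VField I N) z :=
    Eventually.of_forall fun z ↦ contMDiffAt_zeroSection ℝ _
  simpa using hΦ.add h0 h0

lemma sum (hΦ : SmoothTensorial l x Φ) {ι : Type*} (s : Finset ι) {X : ι → VField I N}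
    (hX : ∀ i ∈ s, ∀ᶠ z in l, SmoothAt (X i) z) :
    Φ (∑ i ∈ s, X i) = ∑ i ∈ s, Φ (X i) := by
  classical
  induction s using Finset.induction_on with
  | empty => exact hΦ.zero
  | insert a s ha ih =>
    simp only [Finset.mem_insert, forall_eq_or_imp] at hX
    have hs : ∀ᶠ z in l, SmoothAt (∑ i ∈ s, X i) z := by
      filter_upwards [(eventually_all_finset s).2 hX.2] with z hz using SmoothAt.sum (X := X) hz
    simp only [Finset.sum_insert ha, ← ih hX.2]
    exact hΦ.add hX.1 hs

lemma apply_eq_sum (hΦ : SmoothTensorial l x Φ) (hl : l ≤ 𝓝 x) {X : VField I N}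
    (hX : ∀ᶠ z in l, SmoothAt X z) :
    Φ X = ∑ i, coframe I x i x (X x) • Φ (frame I x i) := by
  have hfr : ∀ᶠ z in l, z ∈ frameSet I x := hl (frameSet_mem_nhds x)
  have h1 : GermEq X (∑ i, (fun y ↦ coframe I x i y (X y)) • frame I x i) x := by
    filter_upwards [frameSet_mem_nhds (I := I) x] with z hz
    rw [Finset.sum_apply]
    exact (sum_coframe_smul_frame hz _).symm
  have hc (i) : ∀ᶠ z in l, SmoothFunAt I (fun y ↦ coframe I x i y (X y)) z := by
    filter_upwards [hX, hfr] with z h h' using coframe_smoothAt h' i h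
  have he (i) : ∀ᶠ z in l, SmoothAt (frame I x i) z := by
    filter_upwards [hfr] with z h using frame_smoothAt h i
  rw [hΦ.congr hl hX h1,
    hΦ.sum (X := fun i ↦ (fun y ↦ coframe I x i y (X y)) • frame I x i)]
  · exact Finset.sum_congr rfl fun i _ ↦ hΦ.smul (hc i) (he i)
  · intro i _
    filter_upwards [hc i, he i] with z h h' using SmoothAt.smul h h'

lemma pointwise (hΦ : SmoothTensorial l x Φ) (hl : l ≤ 𝓝 x) {X Y : VField I N}
    (hX : ∀ᶠ z in l, SmoothAt X z) (hY : ∀ᶠ z in l, SmoothAt Y z) (h : X x = Y x) :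
    Φ X = Φ Y := by
  rw [hΦ.apply_eq_sum hl hX, hΦ.apply_eq_sum hl hY, h]

/-- The linear map on tangent vectors induced by a tensorial operation. -/
def toLinearMap (hΦ : SmoothTensorial l x Φ) (hl : l ≤ 𝓝 x) : TangentSpace I x →ₗ[ℝ] A where
  toFun v := Φ (extField v)
  map_add' u v := by
    have h (w : TangentSpace I x) : ∀ᶠ z in l, SmoothAt (extField w) z :=
      hl (extField_smoothNear w)
    rw [← hΦ.add (h u) (h v)]
    refine hΦ.pointwise hl (h _) ?_ (by simp [extField_self])
    filter_upwards [h u, h v] with z h1 h2 using h1.add h2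
  map_smul' r v := by
    have h (w : TangentSpace I x) : ∀ᶠ z in l, SmoothAt (extField w) z :=
      hl (extField_smoothNear w)
    have hr : ∀ᶠ z in l, SmoothFunAt I (fun _ ↦ r) z :=
      Eventually.of_forall fun z ↦ contMDiffAt_const
    rw [RingHom.id_apply, ← hΦ.smul (f := fun _ ↦ r) hr (h v)]
    refine hΦ.pointwise hl (h _) ?_ (by simp [extField_self])
    filter_upwards [hr, h v] with z h1 h2 using SmoothAt.smul h1 h2

lemma toLinearMap_apply (hΦ : SmoothTensorial l x Φ) (hl : l ≤ 𝓝 x) {X : VField I N}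
    (hX : ∀ᶠ z in l, SmoothAt X z) : hΦ.toLinearMap hl (X x) = Φ X :=
  hΦ.pointwise hl (hl (extField_smoothNear _)) hX (extField_self _)

end SmoothTensorial

/-! ### Lie brackets -/

lemma mlieBracket_smul_right' {X Y : VField I N} {f : N → ℝ} {x : N} (hf : SmoothFunAt I f x)
    (hY : SmoothAt Y x) :
    mlieBracket I X (f • Y) x = dirDeriv X f x • Y x + f x • mlieBracket I X Y x :=
  mlieBracket_smul_right hf.mdiff hY.mdiff

lemma mlieBracket_smul_left' {X Y : VField I N} {f : N → ℝ} {x : N} (hf : SmoothFunAt I f x)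
    (hX : SmoothAt X x) :
    mlieBracket I (f • X) Y x = - dirDeriv Y f x • X x + f x • mlieBracket I X Y x :=
  mlieBracket_smul_left hf.mdiff hX.mdiff

/-- `[X,Y] f = X (Y f) - Y (X f)`. -/
lemma dirDeriv_mlieBracket [Nontrivial E] {X Y : VField I N} {f : N → ℝ} {x : N}
    (hX : SmoothNear X x) (hY : SmoothNear Y x) (hf : SmoothFunNear I f x) :
    dirDeriv (mlieBracket I X Y) f x
      = dirDeriv X (dirDeriv Y f) x - dirDeriv Y (dirDeriv X f) x := by
  have : IsManifold I (minSmoothness ℝ 3) N := by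
    simpa using (inferInstance : IsManifold I 3 N)
  obtain ⟨w, hw⟩ : ∃ w : TangentSpace I x, w ≠ 0 := exists_ne (α := E) 0
  set W : VField I N := extField w with hWdef
  have hW : SmoothNear W x := extField_smoothNear w
  have hs2 {Z : VField I N} (hZ : SmoothNear Z x) :
      ContMDiffAt I I.tangent (minSmoothness ℝ 2) (fun z ↦ (⟨z, Z z⟩ : TangentBundle I N)) x :=
    ContMDiffAt.of_le hZ.smoothAt (by simpa using ENat.LEInfty.out)
  have exp {A B : VField I N} (hA : SmoothNear A x) (hB : SmoothNear B x) :
      mlieBracket I A (mlieBracket I B (f • W)) x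
        = dirDeriv A (dirDeriv B f) x • W x + dirDeriv B f x • mlieBracket I A W x
          + (dirDeriv A f x • mlieBracket I B W x
            + f x • mlieBracket I A (mlieBracket I B W) x) := by
    have h1 : GermEq (mlieBracket I B (f • W)) (dirDeriv B f • W + f • mlieBracket I B W) x := by
      filter_upwards [hf, hW] with z h h' using mlieBracket_smul_right' h h'
    have hBf := hf.self_of_nhds.dirDeriv hB.smoothAt
    have hBW := hB.smoothAt.mlieBracket hW.smoothAt
    rw [(GermEq.refl A x).mlieBracket h1,
      mlieBracket_add_right (SmoothAt.smul hBf hW.smoothAt).mdiff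
        (SmoothAt.smul hf.self_of_nhds hBW).mdiff,
      mlieBracket_smul_right' hBf hW.smoothAt, mlieBracket_smul_right' hf.self_of_nhds hBW]
  have J := leibniz_identity_mlieBracket_apply (hs2 hX) (hs2 hY) (hs2 (SmoothNear.smul hf hW))
  have J0 := leibniz_identity_mlieBracket_apply (hs2 hX) (hs2 hY) (hs2 hW)
  rw [exp hX hY, exp hY hX, mlieBracket_smul_right' hf.self_of_nhds hW.smoothAt, J0] at J
  have hWx : W x = w := extField_self w
  have : (dirDeriv (mlieBracket I X Y) f x
      - (dirDeriv X (dirDeriv Y f) x - dirDeriv Y (dirDeriv X f) x)) • W x = 0 := by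
    rw [sub_smul, sub_smul]
    linear_combination (norm := module) -J
  rw [hWx, smul_eq_zero, or_iff_left hw, sub_eq_zero] at this
  exact this

end Basics

section LeviCivita

variable {E : Type*} [NormedAddCommGroup E] [NormedSpace ℝ E]
  {H : Type*} [TopologicalSpace H] {I : ModelWithCorners ℝ E H}
  {N : Type*} [TopologicalSpace N] [ChartedSpace H N] [IsManifold I ∞ N] [FiniteDimensional ℝ E]

/-- A smooth symmetric nondegenerate bilinear form on the tangent spaces. -/
structure IsMetric (g : MetricField I N) : Prop where
  add_left : ∀ x u v w, g x (u + v) w = g x u w + g x v w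
  smul_left : ∀ x (r : ℝ) u v, g x (r • u) v = r * g x u v
  symm : ∀ x u v, g x u v = g x v u
  nondeg : ∀ x u, (∀ v, g x u v = 0) → u = 0
  smooth : ∀ {X Y : VField I N} {x : N}, SmoothAt X x → SmoothAt Y x →
    SmoothFunAt I (fun z ↦ g z (X z) (Y z)) x

namespace IsMetric

variable {g : MetricField I N} (hg : IsMetric g)
include hg

lemma add_right (x : N) (u v w : TangentSpace I x) : g x u (v + w) = g x u v + g x u w := by
  rw [hg.symm x u, hg.add_left, hg.symm x v, hg.symm x w]

lemma smul_right (x : N) (r : ℝ) (u v : TangentSpace I x) : g x u (r • v) = r * g x u v := by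
  rw [hg.symm x u, hg.smul_left, hg.symm x v]

lemma neg_left (x : N) (u v : TangentSpace I x) : g x (-u) v = - g x u v := by
  rw [← neg_one_smul ℝ u, hg.smul_left]; ring

lemma sub_left (x : N) (u v w : TangentSpace I x) : g x (u - v) w = g x u w - g x v w := by
  rw [sub_eq_add_neg, hg.add_left, hg.neg_left, sub_eq_add_neg]

lemma sub_right (x : N) (u v w : TangentSpace I x) : g x u (v - w) = g x u v - g x u w := by
  rw [hg.symm x u, hg.sub_left, hg.symm x v, hg.symm x w]

lemma zero_left (x : N) (v : TangentSpace I x) : g x 0 v = 0 := by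
  simpa using hg.smul_left x 0 0 v

lemma zero_right (x : N) (v : TangentSpace I x) : g x v 0 = 0 := by
  rw [hg.symm, hg.zero_left]

lemma sum_left (x : N) {ι : Type*} (s : Finset ι) (u : ι → TangentSpace I x)
    (v : TangentSpace I x) : g x (∑ i ∈ s, u i) v = ∑ i ∈ s, g x (u i) v := by
  classical
  induction s using Finset.induction_on with
  | empty => simp [hg.zero_left]
  | insert a s ha ih => rw [Finset.sum_insert ha, Finset.sum_insert ha, hg.add_left, ih]

lemma sum_right (x : N) {ι : Type*} (s : Finset ι) (u : ι → TangentSpace I x)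
    (v : TangentSpace I x) : g x v (∑ i ∈ s, u i) = ∑ i ∈ s, g x v (u i) := by
  simp only [hg.symm x v, hg.sum_left]

lemma ext {x : N} {u v : TangentSpace I x} (h : ∀ w, g x u w = g x v w) : u = v := by
  rw [← sub_eq_zero]
  exact hg.nondeg x _ fun w ↦ by rw [hg.sub_left, h, sub_self]

lemma ext_field {x : N} {u v : TangentSpace I x}
    (h : ∀ Z : VField I N, SmoothNear Z x → g x u (Z x) = g x v (Z x)) : u = v :=
  hg.ext fun w ↦ by simpa [extField_self] using h (extField w) (extField_smoothNear w)

/-- The Riesz representation of a linear form. -/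
lemma exists_repr {x : N} (θ : TangentSpace I x →ₗ[ℝ] ℝ) : ∃ v, ∀ w, g x v w = θ w := by
  have : FiniteDimensional ℝ (TangentSpace I x) := inferInstanceAs (FiniteDimensional ℝ E)
  let B : TangentSpace I x →ₗ[ℝ] Module.Dual ℝ (TangentSpace I x) :=
    LinearMap.mk₂ ℝ (g x) (hg.add_left x) (hg.smul_left x) (hg.add_right x) (hg.smul_right x)
  have hB : Function.Injective B := by
    refine (injective_iff_map_eq_zero B).2 fun u hu ↦ hg.nondeg x u fun v ↦ ?_
    exact congrArg (fun L : Module.Dual ℝ (TangentSpace I x) ↦ L v) hu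
  obtain ⟨v, hv⟩ := (LinearMap.injective_iff_surjective_of_finrank_eq_finrank
    (Subspace.dual_finrank_eq (K := ℝ) (V := TangentSpace I x)).symm).1 hB θ
  exact ⟨v, fun w ↦ congrArg (fun L : Module.Dual ℝ (TangentSpace I x) ↦ L w) hv⟩

lemma smoothFunNear {X Y : VField I N} {x : N} (hX : SmoothNear X x) (hY : SmoothNear Y x) :
    SmoothFunNear I (fun z ↦ g z (X z) (Y z)) x := by
  filter_upwards [hX, hY] with z hXz hYz using hg.smooth hXz hYz

/-- A vector field is smooth if its inner products with smooth fields are. -/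
lemma smoothAt_of_inner {X : VField I N} {x : N}
    (h : ∀ Z : VField I N, SmoothNear Z x → SmoothFunAt I (fun z ↦ g z (X z) (Z z)) x) :
    SmoothAt X x := by
  classical
  let A (z : N) : Matrix (FIdx E) (FIdx E) ℝ := fun i j ↦ g z (frame I x i z) (frame I x j z)
  let b (z : N) : FIdx E → ℝ := fun i ↦ g z (X z) (frame I x i z)
  let c (z : N) : FIdx E → ℝ := fun i ↦ coframe I x i z (X z)
  have smooth_det {B : N → Matrix (FIdx E) (FIdx E) ℝ}
      (hB : ∀ i j, SmoothFunAt I (fun z ↦ B z i j) x) : SmoothFunAt I (fun z ↦ (B z).det) x := by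
    simp only [Matrix.det_apply']
    refine contMDiffAt_finsetSum fun σ _ ↦ ContMDiffAt.mul contMDiffAt_const ?_
    exact contMDiffAt_finsetProd fun i _ ↦ hB _ _
  have hA (i j) : SmoothFunAt I (fun z ↦ A z i j) x :=
    hg.smooth (frame_smoothAt (mem_frameSet x) i) (frame_smoothAt (mem_frameSet x) j)
  have hb (i) : SmoothFunAt I (fun z ↦ b z i) x := h _ (frame_smoothNear x i)
  have hdet : (A x).det ≠ 0 := by
    intro h0
    obtain ⟨v, hv, hv0⟩ := Matrix.exists_mulVec_eq_zero_iff.2 h0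
    have hsum : ∑ j, v j • frame I x j x = 0 := by
      refine hg.nondeg x _ fun w ↦ ?_
      rw [← sum_coframe_smul_frame (mem_frameSet x) w, hg.sum_right]
      refine Finset.sum_eq_zero fun i _ ↦ ?_
      rw [hg.smul_right, hg.symm, hg.sum_right]
      simp only [hg.smul_right]
      have := congrFun hv0 i
      simp only [Matrix.mulVec, dotProduct, Pi.zero_apply, A] at this
      simp only [mul_comm (v _), this, mul_zero]
    apply hv
    have hli : LinearIndependent ℝ fun j ↦ frame I x j x :=
      ((trivializationAt E (TangentSpace I : N → Type _) x).isLocalFrameOn_localFrame_baseSet I 1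
        (Module.finBasis ℝ E)).linearIndependent (mem_frameSet x)
    exact funext (Fintype.linearIndependent_iff.1 hli v hsum)
  have hAc : ∀ᶠ z in 𝓝 x, (A z).mulVec (c z) = b z := by
    filter_upwards [frameSet_mem_nhds (I := I) x] with z hz
    ext i
    simp only [Matrix.mulVec, dotProduct, A, b, c]
    conv_rhs => rw [← sum_coframe_smul_frame hz (X z), hg.symm, hg.sum_right]
    exact Finset.sum_congr rfl fun j _ ↦ by rw [hg.smul_right, mul_comm]
  refine smoothAt_of_coframe fun j ↦ ?_
  have hd := smooth_det hA
  have hn : SmoothFunAt I (fun z ↦ ((A z).updateCol j (b z)).det) x := by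
    refine smooth_det fun i k ↦ ?_
    by_cases hk : k = j
    · subst hk; simpa using hb i
    · simpa [Matrix.updateCol_ne hk] using hA i k
  refine (ContMDiffAt.div₀ hn hd hdet).congr_of_eventuallyEq ?_
  filter_upwards [hAc, hd.continuousAt.eventually_ne hdet] with z hz hz0
  rw [Pi.div_apply, eq_div_iff hz0, ← Matrix.cramer_apply, ← hz, Matrix.cramer_eq_adjugate_mulVec,
    Matrix.mulVec_mulVec, Matrix.adjugate_mul, Matrix.smul_mulVec, Matrix.one_mulVec]
  simp [c, mul_comm]

/-! ### Derivatives of the metric -/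

lemma dirDeriv_add_left (W : VField I N) {X X' Y : VField I N} {x : N} (hX : SmoothAt X x)
    (hX' : SmoothAt X' x) (hY : SmoothAt Y x) :
    dirDeriv W (fun z ↦ g z ((X + X') z) (Y z)) x
      = dirDeriv W (fun z ↦ g z (X z) (Y z)) x + dirDeriv W (fun z ↦ g z (X' z) (Y z)) x := by
  rw [← dirDeriv_add W (hg.smooth hX hY) (hg.smooth hX' hY)]
  simp only [Pi.add_apply, hg.add_left]

lemma dirDeriv_add_right (W : VField I N) {X X' Y : VField I N} {x : N} (hX : SmoothAt X x)
    (hX' : SmoothAt X' x) (hY : SmoothAt Y x) :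
    dirDeriv W (fun z ↦ g z (Y z) ((X + X') z)) x
      = dirDeriv W (fun z ↦ g z (Y z) (X z)) x + dirDeriv W (fun z ↦ g z (Y z) (X' z)) x := by
  rw [← dirDeriv_add W (hg.smooth hY hX) (hg.smooth hY hX')]
  simp only [Pi.add_apply, hg.add_right]

lemma dirDeriv_smul_left (W : VField I N) {f : N → ℝ} {X Y : VField I N} {x : N}
    (hf : SmoothFunAt I f x) (hX : SmoothAt X x) (hY : SmoothAt Y x) :
    dirDeriv W (fun z ↦ g z ((f • X) z) (Y z)) x
      = f x * dirDeriv W (fun z ↦ g z (X z) (Y z)) x + g x (X x) (Y x) * dirDeriv W f x := by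
  rw [← dirDeriv_mul W hf (hg.smooth hX hY)]
  simp only [Pi.smul_apply', hg.smul_left]

lemma dirDeriv_smul_right (W : VField I N) {f : N → ℝ} {X Y : VField I N} {x : N}
    (hf : SmoothFunAt I f x) (hX : SmoothAt X x) (hY : SmoothAt Y x) :
    dirDeriv W (fun z ↦ g z (Y z) ((f • X) z)) x
      = f x * dirDeriv W (fun z ↦ g z (Y z) (X z)) x + g x (Y x) (X x) * dirDeriv W f x := by
  rw [← dirDeriv_mul W hf (hg.smooth hY hX)]
  simp only [Pi.smul_apply', hg.smul_right]

/-! ### The Koszul formula -/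

lemma koszul_tensorial {X Y : VField I N} {x : N} (hX : SmoothAt X x) (hY : SmoothAt Y x) :
    SmoothTensorial (pure x) x (fun Z ↦ koszul g X Y Z x) where
  add {Z Z'} hZ hZ' := by
    rw [eventually_pure] at hZ hZ'
    unfold koszul
    rw [hg.dirDeriv_add_right X hZ hZ' hY, hg.dirDeriv_add_right Y hZ hZ' hX,
      GNat.dirDeriv_add_left, mlieBracket_add_right hZ.mdiff hZ'.mdiff,
      mlieBracket_add_right hZ.mdiff hZ'.mdiff]
    simp only [Pi.add_apply, hg.add_left, hg.add_right]
    ring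
  smul {f Z} hf hZ := by
    rw [eventually_pure] at hf hZ
    unfold koszul
    rw [hg.dirDeriv_smul_right X hf hZ hY, hg.dirDeriv_smul_right Y hf hZ hX,
      GNat.dirDeriv_smul_left, mlieBracket_smul_right' hf hZ, mlieBracket_smul_right' hf hZ]
    simp only [Pi.smul_apply', hg.add_left, hg.smul_left, hg.smul_right, smul_eq_mul]
    rw [hg.symm x (Z x) (Y x), hg.symm x (Z x) (X x)]
    ring

/-- The Levi-Civita connection satisfies the Koszul formula. -/
lemma two_mul_leviCivita {X Y Z : VField I N} {x : N} (hX : SmoothAt X x) (hY : SmoothAt Y x)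
    (hZ : SmoothAt Z x) : 2 * g x (leviCivita g X Y x) (Z x) = koszul g X Y Z x := by
  have hT := hg.koszul_tensorial hX hY
  have hex : ∃ v : TangentSpace I x, ∀ Z : VField I N, SmoothAt Z x →
      2 * g x v (Z x) = koszul g X Y Z x := by
    obtain ⟨v, hv⟩ := hg.exists_repr ((1 / 2 : ℝ) • hT.toLinearMap (pure_le_nhds x))
    refine ⟨v, fun Z hZ ↦ ?_⟩
    rw [hv, LinearMap.smul_apply, hT.toLinearMap_apply (pure_le_nhds x) (eventually_pure.2 hZ),
      smul_eq_mul]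
    ring
  unfold leviCivita
  rw [dif_pos hex]
  exact hex.choose_spec Z hZ

lemma leviCivita_eq_of_koszul {X Y : VField I N} {x : N} (hX : SmoothAt X x) (hY : SmoothAt Y x)
    {v : TangentSpace I x}
    (h : ∀ w : TangentSpace I x, ∃ Z : VField I N, SmoothAt Z x ∧ Z x = w ∧
      2 * g x v w = koszul g X Y Z x) : leviCivita g X Y x = v := by
  refine hg.ext fun w ↦ ?_
  obtain ⟨Z, hZ, hZw, hk⟩ := h w
  have := hg.two_mul_leviCivita hX hY hZ
  rw [← hk, hZw] at this
  linarith

end IsMetric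

lemma koszul_congr {g : MetricField I N} {X X' Y Y' Z : VField I N} {x : N} (hX : GermEq X X' x)
    (hY : GermEq Y Y' x) : koszul g X Y Z x = koszul g X' Y' Z x := by
  have h1 : (fun z ↦ g z (Y z) (Z z)) =ᶠ[𝓝 x] fun z ↦ g z (Y' z) (Z z) := by
    filter_upwards [hY] with z hz; rw [hz]
  have h2 : (fun z ↦ g z (X z) (Z z)) =ᶠ[𝓝 x] fun z ↦ g z (X' z) (Z z) := by
    filter_upwards [hX] with z hz; rw [hz]
  have h3 : (fun z ↦ g z (X z) (Y z)) =ᶠ[𝓝 x] fun z ↦ g z (X' z) (Y' z) := by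
    filter_upwards [hX, hY] with z hz hz'; rw [hz, hz']
  unfold koszul
  rw [dirDeriv_congr h1, dirDeriv_congr h2, dirDeriv_congr h3, dirDeriv_congr_left hX.eq,
    dirDeriv_congr_left hY.eq, hX.mlieBracket hY, hX.mlieBracket (GermEq.refl Z x),
    hY.mlieBracket (GermEq.refl Z x), hX.eq, hY.eq]

lemma leviCivita_congr {g : MetricField I N} {X X' Y Y' : VField I N} {x : N}
    (hX : GermEq X X' x) (hY : GermEq Y Y' x) : leviCivita g X Y x = leviCivita g X' Y' x := by
  classical
  let F (κ : VField I N → ℝ) : TangentSpace I x :=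
    if h : ∃ v : TangentSpace I x, ∀ Z : VField I N, SmoothAt Z x → 2 * g x v (Z x) = κ Z
    then h.choose else 0
  have h : (fun Z ↦ koszul g X Y Z x) = fun Z ↦ koszul g X' Y' Z x :=
    funext fun Z ↦ koszul_congr hX hY
  exact congrArg F h

lemma leviCivita_germEq {g : MetricField I N} {X X' Y Y' : VField I N} {x : N}
    (hX : GermEq X X' x) (hY : GermEq Y Y' x) :
    GermEq (leviCivita g X Y) (leviCivita g X' Y') x := by
  filter_upwards [hX.eventually, hY.eventually] with z h h' using leviCivita_congr h h'

namespace IsMetric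

variable {g : MetricField I N} (hg : IsMetric g)
include hg

lemma leviCivita_add_left {X X' Y : VField I N} {x : N} (hX : SmoothAt X x) (hX' : SmoothAt X' x)
    (hY : SmoothAt Y x) :
    leviCivita g (X + X') Y x = leviCivita g X Y x + leviCivita g X' Y x := by
  refine hg.ext_field fun Z hZ ↦ ?_
  have h := hg.two_mul_leviCivita (hX.add hX') hY hZ.smoothAt
  have h1 := hg.two_mul_leviCivita hX hY hZ.smoothAt
  have h2 := hg.two_mul_leviCivita hX' hY hZ.smoothAt
  unfold koszul at h h1 h2
  rw [hg.dirDeriv_add_left Y hX hX' hZ.smoothAt, hg.dirDeriv_add_left Z hX hX' hY,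
    GNat.dirDeriv_add_left, mlieBracket_add_left hX.mdiff hX'.mdiff,
    mlieBracket_add_left hX.mdiff hX'.mdiff] at h
  simp only [Pi.add_apply, hg.add_left, hg.add_right] at h
  rw [hg.add_left]
  linarith

lemma leviCivita_smul_left {f : N → ℝ} {X Y : VField I N} {x : N} (hf : SmoothFunAt I f x)
    (hX : SmoothAt X x) (hY : SmoothAt Y x) :
    leviCivita g (f • X) Y x = f x • leviCivita g X Y x := by
  refine hg.ext_field fun Z hZ ↦ ?_
  have h := hg.two_mul_leviCivita (SmoothAt.smul hf hX) hY hZ.smoothAt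
  have h1 := hg.two_mul_leviCivita hX hY hZ.smoothAt
  unfold koszul at h h1
  rw [hg.dirDeriv_smul_left Y hf hX hZ.smoothAt, hg.dirDeriv_smul_left Z hf hX hY,
    GNat.dirDeriv_smul_left, mlieBracket_smul_left' hf hX, mlieBracket_smul_left' hf hX] at h
  simp only [Pi.smul_apply', hg.add_left, hg.smul_left, hg.smul_right] at h
  rw [hg.smul_left]
  linear_combination (1 / 2 : ℝ) * h - (1 / 2 : ℝ) * f x * h1

lemma leviCivita_add_right {X Y Y' : VField I N} {x : N} (hX : SmoothAt X x) (hY : SmoothAt Y x)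
    (hY' : SmoothAt Y' x) :
    leviCivita g X (Y + Y') x = leviCivita g X Y x + leviCivita g X Y' x := by
  refine hg.ext_field fun Z hZ ↦ ?_
  have h := hg.two_mul_leviCivita hX (hY.add hY') hZ.smoothAt
  have h1 := hg.two_mul_leviCivita hX hY hZ.smoothAt
  have h2 := hg.two_mul_leviCivita hX hY' hZ.smoothAt
  unfold koszul at h h1 h2
  rw [hg.dirDeriv_add_left X hY hY' hZ.smoothAt, hg.dirDeriv_add_right Z hY hY' hX,
    GNat.dirDeriv_add_left, mlieBracket_add_left hY.mdiff hY'.mdiff,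
    mlieBracket_add_right hY.mdiff hY'.mdiff] at h
  simp only [Pi.add_apply, hg.add_left, hg.add_right] at h
  rw [hg.add_left]
  linarith

lemma leviCivita_smul_right {f : N → ℝ} {X Y : VField I N} {x : N} (hf : SmoothFunAt I f x)
    (hX : SmoothAt X x) (hY : SmoothAt Y x) :
    leviCivita g X (f • Y) x = dirDeriv X f x • Y x + f x • leviCivita g X Y x := by
  refine hg.ext_field fun Z hZ ↦ ?_
  have h := hg.two_mul_leviCivita hX (SmoothAt.smul hf hY) hZ.smoothAt
  have h1 := hg.two_mul_leviCivita hX hY hZ.smoothAt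
  unfold koszul at h h1
  rw [hg.dirDeriv_smul_left X hf hY hZ.smoothAt, hg.dirDeriv_smul_right Z hf hY hX,
    GNat.dirDeriv_smul_left, mlieBracket_smul_left' hf hY, mlieBracket_smul_right' hf hY] at h
  simp only [Pi.smul_apply', hg.add_left, hg.smul_left, hg.smul_right] at h
  rw [hg.symm x (Y x) (X x)] at h
  rw [hg.add_left, hg.smul_left, hg.smul_left]
  linear_combination (1 / 2 : ℝ) * h - (1 / 2 : ℝ) * f x * h1

lemma leviCivita_const_smul_right (r : ℝ) {X Y : VField I N} {x : N}
    (hX : SmoothAt X x) (hY : SmoothAt Y x) :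
    leviCivita g X (r • Y) x = r • leviCivita g X Y x := by
  have := hg.leviCivita_smul_right (f := fun _ ↦ r) contMDiffAt_const hX hY
  rwa [dirDeriv_const, zero_smul, zero_add] at this

lemma leviCivita_sub_right {X Y Y' : VField I N} {x : N} (hX : SmoothAt X x) (hY : SmoothAt Y x)
    (hY' : SmoothAt Y' x) :
    leviCivita g X (Y - Y') x = leviCivita g X Y x - leviCivita g X Y' x := by
  have := hg.leviCivita_add_right hX hY (hY'.const_smul (-1))
  rwa [hg.leviCivita_const_smul_right (-1) hX hY', neg_one_smul, neg_one_smul, ← sub_eq_add_neg,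
    ← sub_eq_add_neg] at this

lemma leviCivita_sum_right {X : VField I N} {ι : Type*} (s : Finset ι) {Y : ι → VField I N} {x : N}
    (hX : SmoothAt X x) (hY : ∀ i ∈ s, SmoothAt (Y i) x) :
    leviCivita g X (∑ i ∈ s, Y i) x = ∑ i ∈ s, leviCivita g X (Y i) x := by
  classical
  induction s using Finset.induction_on with
  | empty =>
    have := hg.leviCivita_const_smul_right 0 hX hX
    simpa using this
  | insert a s ha ih =>
    simp only [Finset.mem_insert, forall_eq_or_imp] at hY
    rw [Finset.sum_insert ha, Finset.sum_insert ha,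
      hg.leviCivita_add_right hX hY.1 (SmoothAt.sum hY.2), ih hY.2]

lemma leviCivita_tensorial {Y : VField I N} {x : N} (hY : SmoothAt Y x) :
    SmoothTensorial (pure x) x (fun X ↦ leviCivita g X Y x) where
  add hX hX' := hg.leviCivita_add_left (eventually_pure.1 hX) (eventually_pure.1 hX') hY
  smul hf hX := hg.leviCivita_smul_left (eventually_pure.1 hf) (eventually_pure.1 hX) hY

lemma leviCivita_pointwise {X X' Y : VField I N} {x : N} (hX : SmoothAt X x) (hX' : SmoothAt X' x)
    (hY : SmoothAt Y x) (h : X x = X' x) : leviCivita g X Y x = leviCivita g X' Y x :=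
  (hg.leviCivita_tensorial hY).pointwise (pure_le_nhds x) (eventually_pure.2 hX)
    (eventually_pure.2 hX') h

lemma leviCivita_sub_left {X X' Y : VField I N} {x : N} (hX : SmoothAt X x) (hX' : SmoothAt X' x)
    (hY : SmoothAt Y x) :
    leviCivita g (X - X') Y x = leviCivita g X Y x - leviCivita g X' Y x := by
  have h1 := hg.leviCivita_smul_left (f := fun _ ↦ (-1 : ℝ)) contMDiffAt_const hX' hY
  have h2 := hg.leviCivita_add_left hX (hX'.const_smul (-1)) hY
  rw [neg_one_smul, ← sub_eq_add_neg] at h2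
  rw [h2, sub_eq_add_neg, ← neg_one_smul ℝ (leviCivita g X' Y x), ← h1]
  congr 2
  ext1 z
  simp

/-- The Levi-Civita connection has no torsion. -/
lemma torsion_free {X Y : VField I N} {x : N} (hX : SmoothAt X x) (hY : SmoothAt Y x) :
    mlieBracket I X Y x = leviCivita g X Y x - leviCivita g Y X x := by
  refine hg.ext_field fun Z hZ ↦ ?_
  have h1 := hg.two_mul_leviCivita hX hY hZ.smoothAt
  have h2 := hg.two_mul_leviCivita hY hX hZ.smoothAt
  unfold koszul at h1 h2
  simp only [fun z ↦ hg.symm z (Y z) (X z)] at h2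
  rw [mlieBracket_swap_apply (V := Y) (W := X), hg.neg_left] at h2
  rw [hg.sub_left]
  linarith

/-- The Levi-Civita connection is metric. -/
lemma dirDeriv_inner {X Y Z : VField I N} {x : N} (hX : SmoothAt X x) (hY : SmoothAt Y x)
    (hZ : SmoothAt Z x) :
    dirDeriv X (fun z ↦ g z (Y z) (Z z)) x
      = g x (leviCivita g X Y x) (Z x) + g x (Y x) (leviCivita g X Z x) := by
  have h1 := hg.two_mul_leviCivita hX hY hZ
  have h2 := hg.two_mul_leviCivita hX hZ hY
  unfold koszul at h1 h2
  simp only [fun z ↦ hg.symm z (Z z) (Y z)] at h2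
  rw [mlieBracket_swap_apply (V := Z) (W := Y), hg.neg_left] at h2
  rw [hg.symm x (Y x)]
  linarith

lemma koszul_smoothAt {X Y Z : VField I N} {x : N} (hX : SmoothAt X x) (hY : SmoothAt Y x)
    (hZ : SmoothAt Z x) : SmoothFunAt I (koszul g X Y Z) x := by
  unfold koszul
  have h1 := SmoothFunAt.dirDeriv hX (hg.smooth hY hZ)
  have h2 := SmoothFunAt.dirDeriv hY (hg.smooth hX hZ)
  have h3 := SmoothFunAt.dirDeriv hZ (hg.smooth hX hY)
  have h4 := hg.smooth (hX.mlieBracket hY) hZ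
  have h5 := hg.smooth (hX.mlieBracket hZ) hY
  have h6 := hg.smooth (hY.mlieBracket hZ) hX
  exact ((((h1.add h2).sub h3).add h4).sub h5).sub h6

lemma leviCivita_smoothAt {X Y : VField I N} {x : N} (hX : SmoothNear X x) (hY : SmoothNear Y x) :
    SmoothAt (leviCivita g X Y) x := by
  refine hg.smoothAt_of_inner fun Z hZ ↦ ?_
  refine (ContMDiffAt.mul (contMDiffAt_const (c := (1 / 2 : ℝ)))
    (hg.koszul_smoothAt hX.smoothAt hY.smoothAt hZ.smoothAt)).congr_of_eventuallyEq ?_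
  filter_upwards [hX, hY, hZ] with z h1 h2 h3
  rw [Pi.mul_apply, ← hg.two_mul_leviCivita h1 h2 h3]
  ring

lemma leviCivita_smoothNear {X Y : VField I N} {x : N} (hX : SmoothNear X x)
    (hY : SmoothNear Y x) : SmoothNear (leviCivita g X Y) x := by
  filter_upwards [hX.eventually, hY.eventually] with z h h' using hg.leviCivita_smoothAt h h'

end IsMetric

end LeviCivita

section Curvature

variable {E : Type*} [NormedAddCommGroup E] [NormedSpace ℝ E]
  {H : Type*} [TopologicalSpace H] {I : ModelWithCorners ℝ E H}
  {N : Type*} [TopologicalSpace N] [ChartedSpace H N] [IsManifold I ∞ N] [FiniteDimensional ℝ E]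

lemma curvature_apply (g : MetricField I N) (X Y Z : VField I N) (x : N) :
    curvature g X Y Z x = leviCivita g X (leviCivita g Y Z) x
      - leviCivita g Y (leviCivita g X Z) x - leviCivita g (mlieBracket I X Y) Z x := rfl

lemma covDerivCurvature_apply (g : MetricField I N) (W X Y Z : VField I N) (x : N) :
    covDerivCurvature g W X Y Z x = leviCivita g W (curvature g X Y Z) x
      - curvature g (leviCivita g W X) Y Z x - curvature g X (leviCivita g W Y) Z x
      - curvature g X Y (leviCivita g W Z) x := rfl

lemma mlieBracket_germEq {X X' Y Y' : VField I N} {x : N} (hX : GermEq X X' x)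
    (hY : GermEq Y Y' x) : GermEq (mlieBracket I X Y) (mlieBracket I X' Y') x := by
  filter_upwards [hX.eventually, hY.eventually] with z h h' using h.mlieBracket h'

lemma curvature_congr {g : MetricField I N} {X X' Y Y' Z Z' : VField I N} {x : N}
    (hX : GermEq X X' x) (hY : GermEq Y Y' x) (hZ : GermEq Z Z' x) :
    curvature g X Y Z x = curvature g X' Y' Z' x := by
  rw [curvature_apply, curvature_apply, leviCivita_congr hX (leviCivita_germEq hY hZ),
    leviCivita_congr hY (leviCivita_germEq hX hZ), leviCivita_congr (mlieBracket_germEq hX hY) hZ]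

lemma SmoothTensorial.sum_two {A : Type*} [AddCommGroup A] [Module ℝ A] {l : Filter N} {x : N}
    {Φ Ψ : VField I N → A} (hΦ : SmoothTensorial l x Φ) (hΨ : SmoothTensorial l x Ψ) :
    SmoothTensorial l x (fun X ↦ Φ X + Ψ X) where
  add hX hY := by rw [hΦ.add hX hY, hΨ.add hX hY]; abel
  smul hf hX := by rw [hΦ.smul hf hX, hΨ.smul hf hX, smul_add]

lemma SmoothTensorial.of_eq {A : Type*} [AddCommGroup A] [Module ℝ A] {l : Filter N} {x : N}
    {Φ Ψ : VField I N → A} (hΦ : SmoothTensorial l x Φ) (h : ∀ X, Ψ X = Φ X) :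
    SmoothTensorial l x Ψ := by
  rwa [show Ψ = Φ from funext h]

namespace IsMetric

variable {g : MetricField I N} (hg : IsMetric g)
include hg

lemma curvature_smoothNear {X Y Z : VField I N} {x : N} (hX : SmoothNear X x)
    (hY : SmoothNear Y x) (hZ : SmoothNear Z x) : SmoothNear (curvature g X Y Z) x :=
  ((hg.leviCivita_smoothNear hX (hg.leviCivita_smoothNear hY hZ)).sub
    (hg.leviCivita_smoothNear hY (hg.leviCivita_smoothNear hX hZ))).sub
    (hg.leviCivita_smoothNear (hX.mlieBracket hY) hZ)

lemma curvature_swap {X Y Z : VField I N} {x : N} (hX : SmoothNear X x)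
    (hY : SmoothNear Y x) (hZ : SmoothNear Z x) :
    curvature g X Y Z x = - curvature g Y X Z x := by
  rw [curvature_apply, curvature_apply, mlieBracket_swap (V := X)]
  have h := hg.leviCivita_smul_left (f := fun _ ↦ (-1 : ℝ)) contMDiffAt_const
    (hY.mlieBracket hX).smoothAt hZ.smoothAt
  have h' : (fun _ : N ↦ (-1 : ℝ)) • mlieBracket I Y X = - mlieBracket I Y X := by
    ext1 z; simp
  rw [h'] at h
  rw [h, neg_one_smul]
  abel

lemma curvature_tensorial₁ {Y Z : VField I N} {x : N} (hY : SmoothNear Y x)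
    (hZ : SmoothNear Z x) : SmoothTensorial (𝓝 x) x (fun X ↦ curvature g X Y Z x) where
  add {X X'} hX hX' := by
    have hX : SmoothNear X x := hX
    have hX' : SmoothNear X' x := hX'
    have h1 : GermEq (leviCivita g (X + X') Z) (leviCivita g X Z + leviCivita g X' Z) x := by
      filter_upwards [hX, hX', hZ] with z h h' h'' using hg.leviCivita_add_left h h' h''
    have h2 : GermEq (mlieBracket I (X + X') Y) (mlieBracket I X Y + mlieBracket I X' Y) x := by
      filter_upwards [hX, hX'] with z h h' using mlieBracket_add_left h.mdiff h'.mdiff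
    simp only [curvature_apply]
    rw [leviCivita_congr (GermEq.refl Y x) h1, leviCivita_congr h2 (GermEq.refl Z x),
      hg.leviCivita_add_left hX.smoothAt hX'.smoothAt (hg.leviCivita_smoothAt hY hZ),
      hg.leviCivita_add_right hY.smoothAt (hg.leviCivita_smoothAt hX hZ)
        (hg.leviCivita_smoothAt hX' hZ),
      hg.leviCivita_add_left (hX.mlieBracket hY).smoothAt (hX'.mlieBracket hY).smoothAt
        hZ.smoothAt]
    abel
  smul {f X} hf hX := by
    have hf : SmoothFunNear I f x := hf
    have hX : SmoothNear X x := hX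
    have hfx : SmoothFunAt I f x := hf.self_of_nhds
    have h1 : GermEq (leviCivita g (f • X) Z) (f • leviCivita g X Z) x := by
      filter_upwards [hf, hX, hZ] with z h h' h'' using hg.leviCivita_smul_left h h' h''
    have h2 : GermEq (mlieBracket I (f • X) Y) (f • mlieBracket I X Y - dirDeriv Y f • X) x := by
      filter_upwards [hf, hX] with z h h'
      rw [mlieBracket_smul_left' h h']
      simp only [Pi.sub_apply, Pi.smul_apply']
      module
    have hXY := (hX.mlieBracket hY).smoothAt
    have hYf := SmoothFunAt.dirDeriv hY.smoothAt hfx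
    simp only [curvature_apply]
    rw [leviCivita_congr (GermEq.refl Y x) h1, leviCivita_congr h2 (GermEq.refl Z x),
      hg.leviCivita_smul_left hfx hX.smoothAt (hg.leviCivita_smoothAt hY hZ),
      hg.leviCivita_smul_right hfx hY.smoothAt (hg.leviCivita_smoothAt hX hZ),
      hg.leviCivita_sub_left (SmoothAt.smul hfx hXY) (SmoothAt.smul hYf hX.smoothAt) hZ.smoothAt,
      hg.leviCivita_smul_left hfx hXY hZ.smoothAt,
      hg.leviCivita_smul_left hYf hX.smoothAt hZ.smoothAt]
    module

lemma curvature_tensorial₂ {X Z : VField I N} {x : N} (hX : SmoothNear X x)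
    (hZ : SmoothNear Z x) : SmoothTensorial (𝓝 x) x (fun Y ↦ curvature g X Y Z x) where
  add {Y Y'} hY hY' := by
    rw [hg.curvature_swap hX (SmoothNear.add hY hY') hZ, hg.curvature_swap hX hY hZ,
      hg.curvature_swap hX hY' hZ, (hg.curvature_tensorial₁ hX hZ).add hY hY']
    abel
  smul {f Y} hf hY := by
    rw [hg.curvature_swap hX (SmoothNear.smul hf hY) hZ, hg.curvature_swap hX hY hZ,
      (hg.curvature_tensorial₁ hX hZ).smul hf hY, smul_neg]

lemma curvature_tensorial₃ [Nontrivial E] {X Y : VField I N} {x : N} (hX : SmoothNear X x)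
    (hY : SmoothNear Y x) : SmoothTensorial (𝓝 x) x (fun Z ↦ curvature g X Y Z x) where
  add {Z Z'} hZ hZ' := by
    have hZ : SmoothNear Z x := hZ
    have hZ' : SmoothNear Z' x := hZ'
    have key {A : VField I N} (hA : SmoothNear A x) :
        GermEq (leviCivita g A (Z + Z')) (leviCivita g A Z + leviCivita g A Z') x := by
      filter_upwards [hA, hZ, hZ'] with z h h' h'' using hg.leviCivita_add_right h h' h''
    simp only [curvature_apply]
    rw [leviCivita_congr (GermEq.refl Y x) (key hX), leviCivita_congr (GermEq.refl X x) (key hY),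
      hg.leviCivita_add_right hX.smoothAt (hg.leviCivita_smoothAt hY hZ)
        (hg.leviCivita_smoothAt hY hZ'),
      hg.leviCivita_add_right hY.smoothAt (hg.leviCivita_smoothAt hX hZ)
        (hg.leviCivita_smoothAt hX hZ'),
      hg.leviCivita_add_right (hX.mlieBracket hY).smoothAt hZ.smoothAt hZ'.smoothAt]
    abel
  smul {f Z} hf hZ := by
    have hf : SmoothFunNear I f x := hf
    have hZ : SmoothNear Z x := hZ
    have hfx : SmoothFunAt I f x := hf.self_of_nhds
    have key {A B : VField I N} (hA : SmoothNear A x) (hB : SmoothNear B x) :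
        leviCivita g A (leviCivita g B (f • Z)) x
          = dirDeriv A (dirDeriv B f) x • Z x + dirDeriv B f x • leviCivita g A Z x
            + (dirDeriv A f x • leviCivita g B Z x
              + f x • leviCivita g A (leviCivita g B Z) x) := by
      have h1 : GermEq (leviCivita g B (f • Z)) (dirDeriv B f • Z + f • leviCivita g B Z) x := by
        filter_upwards [hf, hB, hZ] with z h h' h'' using hg.leviCivita_smul_right h h' h''
      have hBf := SmoothFunAt.dirDeriv hB.smoothAt hfx
      have hBZ := hg.leviCivita_smoothAt hB hZ
      rw [leviCivita_congr (GermEq.refl A x) h1,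
        hg.leviCivita_add_right hA.smoothAt (SmoothAt.smul hBf hZ.smoothAt)
          (SmoothAt.smul hfx hBZ),
        hg.leviCivita_smul_right hBf hA.smoothAt hZ.smoothAt,
        hg.leviCivita_smul_right hfx hA.smoothAt hBZ]
    simp only [curvature_apply]
    rw [key hX hY, key hY hX,
      hg.leviCivita_smul_right hfx (hX.mlieBracket hY).smoothAt hZ.smoothAt,
      dirDeriv_mlieBracket hX hY hf]
    module

variable [Nontrivial E]

/-- The curvature is a tensor. -/
lemma curvature_eq {X Y Z : VField I N} {x : N} (hX : SmoothNear X x)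
    (hY : SmoothNear Y x) (hZ : SmoothNear Z x) :
    curvature g X Y Z x = curvatureAt g (X x) (Y x) (Z x) := by
  have eX := extField_smoothNear (X x)
  have eY := extField_smoothNear (Y x)
  have eZ := extField_smoothNear (Z x)
  unfold curvatureAt
  rw [(hg.curvature_tensorial₁ hY hZ).pointwise le_rfl hX eX (extField_self _).symm,
    (hg.curvature_tensorial₂ eX hZ).pointwise le_rfl hY eY (extField_self _).symm,
    (hg.curvature_tensorial₃ eX eY).pointwise le_rfl hZ eZ (extField_self _).symm]

lemma curvatureAt_add_left (x : N) (u u' v w : TangentSpace I x) :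
    curvatureAt g (u + u') v w = curvatureAt g u v w + curvatureAt g u' v w :=
  ((hg.curvature_tensorial₁ (extField_smoothNear v) (extField_smoothNear w)).toLinearMap
    le_rfl).map_add u u'

lemma curvatureAt_smul_left (x : N) (r : ℝ) (u v w : TangentSpace I x) :
    curvatureAt g (r • u) v w = r • curvatureAt g u v w :=
  ((hg.curvature_tensorial₁ (extField_smoothNear v) (extField_smoothNear w)).toLinearMap
    le_rfl).map_smul r u

lemma curvatureAt_add_mid (x : N) (u v v' w : TangentSpace I x) :
    curvatureAt g u (v + v') w = curvatureAt g u v w + curvatureAt g u v' w :=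
  ((hg.curvature_tensorial₂ (extField_smoothNear u) (extField_smoothNear w)).toLinearMap
    le_rfl).map_add v v'

lemma curvatureAt_smul_mid (x : N) (r : ℝ) (u v w : TangentSpace I x) :
    curvatureAt g u (r • v) w = r • curvatureAt g u v w :=
  ((hg.curvature_tensorial₂ (extField_smoothNear u) (extField_smoothNear w)).toLinearMap
    le_rfl).map_smul r v

lemma curvatureAt_add_right (x : N) (u v w w' : TangentSpace I x) :
    curvatureAt g u v (w + w') = curvatureAt g u v w + curvatureAt g u v w' :=
  ((hg.curvature_tensorial₃ (extField_smoothNear u) (extField_smoothNear v)).toLinearMap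
    le_rfl).map_add w w'

lemma curvatureAt_smul_right (x : N) (r : ℝ) (u v w : TangentSpace I x) :
    curvatureAt g u v (r • w) = r • curvatureAt g u v w :=
  ((hg.curvature_tensorial₃ (extField_smoothNear u) (extField_smoothNear v)).toLinearMap
    le_rfl).map_smul r w

lemma curvatureAt_swap (x : N) (u v w : TangentSpace I x) :
    curvatureAt g u v w = - curvatureAt g v u w :=
  hg.curvature_swap (extField_smoothNear u) (extField_smoothNear v) (extField_smoothNear w)

/-- The first Bianchi identity. -/
lemma bianchi (x : N) (u v w : TangentSpace I x) :
    curvatureAt g u v w + curvatureAt g v w u + curvatureAt g w u v = 0 := by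
  have : IsManifold I (minSmoothness ℝ 3) N := by
    simpa using (inferInstance : IsManifold I 3 N)
  have hX := extField_smoothNear u
  have hY := extField_smoothNear v
  have hZ := extField_smoothNear w
  unfold curvatureAt
  set X : VField I N := extField u
  set Y : VField I N := extField v
  set Z : VField I N := extField w
  have hs2 {Z : VField I N} (hZ : SmoothNear Z x) :
      ContMDiffAt I I.tangent (minSmoothness ℝ 2) (fun z ↦ (⟨z, Z z⟩ : TangentBundle I N)) x :=
    ContMDiffAt.of_le hZ.smoothAt (by simpa using ENat.LEInfty.out)
  have J := leibniz_identity_mlieBracket_apply (hs2 hX) (hs2 hY) (hs2 hZ)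
  have T {A B C : VField I N} (hA : SmoothNear A x) (hB : SmoothNear B x) (hC : SmoothNear C x) :
      mlieBracket I A (mlieBracket I B C) x
        = leviCivita g A (leviCivita g B C) x - leviCivita g A (leviCivita g C B) x
          - leviCivita g (mlieBracket I B C) A x := by
    have h : GermEq (mlieBracket I B C) (leviCivita g B C - leviCivita g C B) x := by
      filter_upwards [hB, hC] with z h h' using hg.torsion_free h h'
    rw [hg.torsion_free hA.smoothAt (hB.mlieBracket hC).smoothAt,
      leviCivita_congr (GermEq.refl A x) h, hg.leviCivita_sub_right hA.smoothAt
        (hg.leviCivita_smoothAt hB hC) (hg.leviCivita_smoothAt hC hB)]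
  have neg_left {A B C : VField I N} (hA : SmoothNear A x) (hB : SmoothNear B x)
      (hC : SmoothNear C x) :
      leviCivita g (mlieBracket I A B) C x = - leviCivita g (mlieBracket I B A) C x := by
    have h := hg.curvature_swap hA hB hC
    rw [curvature_apply, curvature_apply] at h
    linear_combination (norm := module) -h
  have J' : mlieBracket I (mlieBracket I X Y) Z x = - mlieBracket I Z (mlieBracket I X Y) x :=
    mlieBracket_swap_apply
  rw [J', T hX hY hZ, T hZ hX hY, T hY hX hZ] at J
  simp only [curvature_apply]
  rw [neg_left hZ hX hY]
  linear_combination (norm := module) J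

lemma inner_curvatureAt_skew (x : N) (u v w s : TangentSpace I x) :
    g x (curvatureAt g u v w) s = - g x w (curvatureAt g u v s) := by
  have hX := extField_smoothNear u
  have hY := extField_smoothNear v
  have hZ := extField_smoothNear w
  have hW := extField_smoothNear s
  have eZ : (extField w : VField I N) x = w := extField_self w
  have eW : (extField s : VField I N) x = s := extField_self s
  unfold curvatureAt
  set X : VField I N := extField u
  set Y : VField I N := extField v
  set Z : VField I N := extField w
  set W : VField I N := extField s
  have key {A B : VField I N} (hA : SmoothNear A x) (hB : SmoothNear B x) :
      dirDeriv A (dirDeriv B (fun z ↦ g z (Z z) (W z))) x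
        = g x (leviCivita g A (leviCivita g B Z) x) (W x)
          + g x (leviCivita g B Z x) (leviCivita g A W x)
          + (g x (leviCivita g A Z x) (leviCivita g B W x)
            + g x (Z x) (leviCivita g A (leviCivita g B W) x)) := by
    have h : dirDeriv B (fun z ↦ g z (Z z) (W z)) =ᶠ[𝓝 x]
        fun z ↦ g z (leviCivita g B Z z) (W z) + g z (Z z) (leviCivita g B W z) := by
      filter_upwards [hB, hZ, hW] with z h h' h'' using hg.dirDeriv_inner h h' h''
    have hBZ := hg.leviCivita_smoothAt hB hZ
    have hBW := hg.leviCivita_smoothAt hB hW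
    rw [dirDeriv_congr h, dirDeriv_add A (hg.smooth hBZ hW.smoothAt) (hg.smooth hZ.smoothAt hBW),
      hg.dirDeriv_inner hA.smoothAt hBZ hW.smoothAt, hg.dirDeriv_inner hA.smoothAt hZ.smoothAt hBW]
  have h := dirDeriv_mlieBracket hX hY (hg.smoothFunNear hZ hW)
  rw [key hX hY, key hY hX, hg.dirDeriv_inner (hX.mlieBracket hY).smoothAt hZ.smoothAt
    hW.smoothAt] at h
  simp only [curvature_apply, hg.sub_left, hg.sub_right]
  rw [eZ, eW] at h
  linarith

/-- The pair symmetry of the curvature. -/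
lemma inner_curvatureAt_pair (x : N) (u v w s : TangentSpace I x) :
    g x (curvatureAt g u v w) s = g x (curvatureAt g w s u) v := by
  have B (a b c d : TangentSpace I x) : g x (curvatureAt g a b c) d
      + g x (curvatureAt g b c a) d + g x (curvatureAt g c a b) d = 0 := by
    rw [← hg.add_left, ← hg.add_left, hg.bianchi, hg.zero_left]
  have S (a b c d : TangentSpace I x) :
      g x (curvatureAt g a b c) d = - g x (curvatureAt g a b d) c := by
    rw [hg.inner_curvatureAt_skew, hg.symm]
  have A (a b c d : TangentSpace I x) :
      g x (curvatureAt g a b c) d = - g x (curvatureAt g b a c) d := by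
    rw [hg.curvatureAt_swap, hg.neg_left]
  linarith [B u v w s, B v w s u, B w s u v, B s u v w, S u v w s, S v w u s, S w u v s,
    S v w s u, S w s v u, S s v w u, S w s u v, S s u w v, S u w s v, S s u v w, S u v s w,
    S v s u w, A u v w s, A w s u v, A s u v w, A v w s u, A w u v s, A s v w u, A u w s v,
    A v s u w]

/-! ### The covariant derivative of the curvature -/

lemma covDerivCurvature_tensorial₀ {X Y Z : VField I N} {x : N} (hX : SmoothNear X x)
    (hY : SmoothNear Y x) (hZ : SmoothNear Z x) :
    SmoothTensorial (𝓝 x) x (fun W ↦ covDerivCurvature g W X Y Z x) where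
  add {W W'} hW hW' := by
    have hW : SmoothNear W x := hW
    have hW' : SmoothNear W' x := hW'
    have key {A : VField I N} (hA : SmoothNear A x) :
        GermEq (leviCivita g (W + W') A) (leviCivita g W A + leviCivita g W' A) x := by
      filter_upwards [hW, hW', hA] with z h h' h'' using hg.leviCivita_add_left h h' h''
    have r := GermEq.refl (I := I) (N := N)
    simp only [covDerivCurvature_apply]
    rw [hg.leviCivita_add_left hW.smoothAt hW'.smoothAt
        (hg.curvature_smoothNear hX hY hZ).smoothAt,
      curvature_congr (key hX) (r Y x) (r Z x), curvature_congr (r X x) (key hY) (r Z x),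
      curvature_congr (r X x) (r Y x) (key hZ),
      (hg.curvature_tensorial₁ hY hZ).add (hg.leviCivita_smoothNear hW hX)
        (hg.leviCivita_smoothNear hW' hX),
      (hg.curvature_tensorial₂ hX hZ).add (hg.leviCivita_smoothNear hW hY)
        (hg.leviCivita_smoothNear hW' hY),
      (hg.curvature_tensorial₃ hX hY).add (hg.leviCivita_smoothNear hW hZ)
        (hg.leviCivita_smoothNear hW' hZ)]
    abel
  smul {f W} hf hW := by
    have hf : SmoothFunNear I f x := hf
    have hW : SmoothNear W x := hW
    have key {A : VField I N} (hA : SmoothNear A x) :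
        GermEq (leviCivita g (f • W) A) (f • leviCivita g W A) x := by
      filter_upwards [hf, hW, hA] with z h h' h'' using hg.leviCivita_smul_left h h' h''
    have r := GermEq.refl (I := I) (N := N)
    simp only [covDerivCurvature_apply]
    rw [hg.leviCivita_smul_left hf.self_of_nhds hW.smoothAt
        (hg.curvature_smoothNear hX hY hZ).smoothAt,
      curvature_congr (key hX) (r Y x) (r Z x), curvature_congr (r X x) (key hY) (r Z x),
      curvature_congr (r X x) (r Y x) (key hZ),
      (hg.curvature_tensorial₁ hY hZ).smul hf (hg.leviCivita_smoothNear hW hX),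
      (hg.curvature_tensorial₂ hX hZ).smul hf (hg.leviCivita_smoothNear hW hY),
      (hg.curvature_tensorial₃ hX hY).smul hf (hg.leviCivita_smoothNear hW hZ)]
    module

/-- If `T` is a tensorial operation on vector fields, then so is `∇_W T`. -/
lemma covDeriv_tensorial {W : VField I N} {x : N} (hW : SmoothNear W x)
    {T : VField I N → VField I N} {Φ : VField I N → TangentSpace I x}
    (hT : ∀ᶠ z in 𝓝 x, SmoothTensorial (𝓝 z) z (fun X ↦ T X z))
    (hTs : ∀ X, SmoothNear X x → SmoothNear (T X) x)
    (hΦ : SmoothTensorial (𝓝 x) x Φ) :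
    SmoothTensorial (𝓝 x) x
      (fun X ↦ leviCivita g W (T X) x - T (leviCivita g W X) x - Φ X) where
  add {X X'} hX hX' := by
    have hX : SmoothNear X x := hX
    have hX' : SmoothNear X' x := hX'
    have h1 : GermEq (T (X + X')) (T X + T X') x := by
      filter_upwards [hT, hX.eventually, hX'.eventually] with z h h' h'' using h.add h' h''
    have h2 : GermEq (leviCivita g W (X + X')) (leviCivita g W X + leviCivita g W X') x := by
      filter_upwards [hW, hX, hX'] with z h h' h'' using hg.leviCivita_add_right h h' h''
    have hd := hg.leviCivita_smoothNear hW hX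
    have hd' := hg.leviCivita_smoothNear hW hX'
    rw [leviCivita_congr (GermEq.refl W x) h1,
      hT.self_of_nhds.congr le_rfl (hg.leviCivita_smoothNear hW (hX.add hX')) h2,
      hT.self_of_nhds.add hd hd', hΦ.add hX hX',
      hg.leviCivita_add_right hW.smoothAt (hTs X hX).smoothAt (hTs X' hX').smoothAt]
    abel
  smul {f X} hf hX := by
    have hf : SmoothFunNear I f x := hf
    have hX : SmoothNear X x := hX
    have h1 : GermEq (T (f • X)) (f • T X) x := by
      filter_upwards [hT, eventually_eventually_nhds.2 hf, hX.eventually] with z h h' h''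
        using h.smul h' h''
    have h2 : GermEq (leviCivita g W (f • X)) (dirDeriv W f • X + f • leviCivita g W X) x := by
      filter_upwards [hW, hf, hX] with z h h' h'' using hg.leviCivita_smul_right h' h h''
    have hd := hg.leviCivita_smoothNear hW hX
    have hWf := SmoothFunNear.dirDeriv hW hf
    rw [leviCivita_congr (GermEq.refl W x) h1,
      hT.self_of_nhds.congr le_rfl (hg.leviCivita_smoothNear hW (SmoothNear.smul hf hX)) h2,
      hT.self_of_nhds.add (SmoothNear.smul hWf hX) (SmoothNear.smul hf hd),
      hT.self_of_nhds.smul hWf hX, hT.self_of_nhds.smul hf hd, hΦ.smul hf hX,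
      hg.leviCivita_smul_right hf.self_of_nhds hW.smoothAt (hTs X hX).smoothAt]
    module

lemma covDerivCurvature_tensorial₁ {W Y Z : VField I N} {x : N} (hW : SmoothNear W x)
    (hY : SmoothNear Y x) (hZ : SmoothNear Z x) :
    SmoothTensorial (𝓝 x) x (fun X ↦ covDerivCurvature g W X Y Z x) := by
  have hWY := hg.leviCivita_smoothNear hW hY
  have hWZ := hg.leviCivita_smoothNear hW hZ
  have h := hg.covDeriv_tensorial hW (T := fun X ↦ curvature g X Y Z)
    (Φ := fun X ↦ curvature g X (leviCivita g W Y) Z x + curvature g X Y (leviCivita g W Z) x)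
    (by filter_upwards [hY.eventually, hZ.eventually] with z h h'
          using hg.curvature_tensorial₁ h h')
    (fun X hX ↦ hg.curvature_smoothNear hX hY hZ)
    ((hg.curvature_tensorial₁ hWY hZ).sum_two (hg.curvature_tensorial₁ hY hWZ))
  refine h.of_eq fun X ↦ ?_
  rw [covDerivCurvature_apply]
  abel

lemma covDerivCurvature_tensorial₂ {W X Z : VField I N} {x : N} (hW : SmoothNear W x)
    (hX : SmoothNear X x) (hZ : SmoothNear Z x) :
    SmoothTensorial (𝓝 x) x (fun Y ↦ covDerivCurvature g W X Y Z x) := by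
  have hWX := hg.leviCivita_smoothNear hW hX
  have hWZ := hg.leviCivita_smoothNear hW hZ
  have h := hg.covDeriv_tensorial hW (T := fun Y ↦ curvature g X Y Z)
    (Φ := fun Y ↦ curvature g (leviCivita g W X) Y Z x + curvature g X Y (leviCivita g W Z) x)
    (by filter_upwards [hX.eventually, hZ.eventually] with z h h'
          using hg.curvature_tensorial₂ h h')
    (fun Y hY ↦ hg.curvature_smoothNear hX hY hZ)
    ((hg.curvature_tensorial₂ hWX hZ).sum_two (hg.curvature_tensorial₂ hX hWZ))
  refine h.of_eq fun Y ↦ ?_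
  rw [covDerivCurvature_apply]
  abel

lemma covDerivCurvature_tensorial₃ {W X Y : VField I N} {x : N} (hW : SmoothNear W x)
    (hX : SmoothNear X x) (hY : SmoothNear Y x) :
    SmoothTensorial (𝓝 x) x (fun Z ↦ covDerivCurvature g W X Y Z x) := by
  have hWX := hg.leviCivita_smoothNear hW hX
  have hWY := hg.leviCivita_smoothNear hW hY
  have h := hg.covDeriv_tensorial hW (T := fun Z ↦ curvature g X Y Z)
    (Φ := fun Z ↦ curvature g (leviCivita g W X) Y Z x + curvature g X (leviCivita g W Y) Z x)
    (by filter_upwards [hX.eventually, hY.eventually] with z h h'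
          using hg.curvature_tensorial₃ h h')
    (fun Z hZ ↦ hg.curvature_smoothNear hX hY hZ)
    ((hg.curvature_tensorial₃ hWX hY).sum_two (hg.curvature_tensorial₃ hX hWY))
  refine h.of_eq fun Z ↦ ?_
  rw [covDerivCurvature_apply]
  abel

/-- `∇R` is a tensor. -/
lemma covDerivCurvature_eq {W X Y Z : VField I N} {x : N} (hW : SmoothNear W x)
    (hX : SmoothNear X x) (hY : SmoothNear Y x) (hZ : SmoothNear Z x) :
    covDerivCurvature g W X Y Z x = covDerivCurvatureAt g (W x) (X x) (Y x) (Z x) := by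
  have eW := extField_smoothNear (W x)
  have eX := extField_smoothNear (X x)
  have eY := extField_smoothNear (Y x)
  have eZ := extField_smoothNear (Z x)
  unfold covDerivCurvatureAt
  rw [(hg.covDerivCurvature_tensorial₀ hX hY hZ).pointwise le_rfl hW eW (extField_self _).symm,
    (hg.covDerivCurvature_tensorial₁ eW hY hZ).pointwise le_rfl hX eX (extField_self _).symm,
    (hg.covDerivCurvature_tensorial₂ eW eX hZ).pointwise le_rfl hY eY (extField_self _).symm,
    (hg.covDerivCurvature_tensorial₃ eW eX eY).pointwise le_rfl hZ eZ (extField_self _).symm]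

end IsMetric

end Curvature

section Lifts

variable {E : Type*} [NormedAddCommGroup E] [NormedSpace ℝ E]
  {H : Type*} [TopologicalSpace H] {I : ModelWithCorners ℝ E H}

/-- The derivative of the function `f` along the tangent vector `v`. -/
def vderiv {N : Type*} [TopologicalSpace N] [ChartedSpace H N] {x : N} (f : N → ℝ)
    (v : TangentSpace I x) : ℝ :=
  (mfderiv I 𝓘(ℝ, ℝ) f x : TangentSpace I x → ℝ) v

lemma dirDeriv_eq_vderiv {N : Type*} [TopologicalSpace N] [ChartedSpace H N] (X : VField I N)
    (f : N → ℝ) (x : N) : dirDeriv X f x = vderiv f (X x) := rfl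

lemma vderiv_vadd {N : Type*} [TopologicalSpace N] [ChartedSpace H N] {x : N} (f : N → ℝ)
    (u v : TangentSpace I x) : vderiv f (u + v) = vderiv f u + vderiv f v :=
  map_add (mfderiv I 𝓘(ℝ, ℝ) f x) u v

lemma vderiv_vsub {N : Type*} [TopologicalSpace N] [ChartedSpace H N] {x : N} (f : N → ℝ)
    (u v : TangentSpace I x) : vderiv f (u - v) = vderiv f u - vderiv f v :=
  map_sub (mfderiv I 𝓘(ℝ, ℝ) f x) u v

lemma vderiv_vsmul {N : Type*} [TopologicalSpace N] [ChartedSpace H N] {x : N} (f : N → ℝ)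
    (r : ℝ) (v : TangentSpace I x) : vderiv f (r • v) = r * vderiv f v :=
  map_smul (mfderiv I 𝓘(ℝ, ℝ) f x) r v

variable {M : Type*} [TopologicalSpace M] [ChartedSpace H M] [IsManifold I ∞ M]
  [FiniteDimensional ℝ E]

/-- The fibrewise linear function on `TM` defined by the vector field `W`. -/
def hat (g : MetricField I M) (W : VField I M) (q : TangentBundle I M) : ℝ :=
  g q.proj q.snd (W q.proj)

lemma smoothAt_proj (p : TangentBundle I M) :
    ContMDiffAt I.tangent I ∞ (fun q : TangentBundle I M ↦ q.proj) p :=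
  contMDiffAt_proj (TangentSpace I : M → Type _)

lemma tendsto_proj (p : TangentBundle I M) :
    Tendsto (fun q : TangentBundle I M ↦ q.proj) (𝓝 p) (𝓝 p.proj) :=
  (smoothAt_proj p).continuousAt

lemma SmoothFunAt.comp_proj {f : M → ℝ} {p : TangentBundle I M} (hf : SmoothFunAt I f p.proj) :
    SmoothFunAt I.tangent (fun q : TangentBundle I M ↦ f q.proj) p :=
  ContMDiffAt.comp p hf (smoothAt_proj p)

lemma SmoothFunNear.comp_proj {f : M → ℝ} {p : TangentBundle I M}
    (hf : SmoothFunNear I f p.proj) :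
    SmoothFunNear I.tangent (fun q : TangentBundle I M ↦ f q.proj) p :=
  ((tendsto_proj p).eventually hf).mono fun _ hq ↦ SmoothFunAt.comp_proj hq

lemma smoothAt_trivializationAt_snd {x : M} {p : TangentBundle I M} (hp : p.proj ∈ frameSet I x) :
    ContMDiffAt I.tangent 𝓘(ℝ, E) ∞ (fun q : TangentBundle I M ↦
      ((trivializationAt E (TangentSpace I : M → Type _) x) q).2) p := by
  set e := trivializationAt E (TangentSpace I : M → Type _) x
  have hs : p ∈ e.source := e.mem_source.2 hp
  have := (Trivialization.contMDiffOn (IB := I) (n := ∞) e).contMDiffAt (e.open_source.mem_nhds hs)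
  exact this.snd

namespace IsMetric

variable {g : MetricField I M} (hg : IsMetric g)
include hg

lemma hat_smoothAt {W : VField I M} {p : TangentBundle I M} (hW : SmoothAt W p.proj) :
    SmoothFunAt I.tangent (hat g W) p := by
  have h1 (i : FIdx E) : SmoothFunAt I.tangent (fun q : TangentBundle I M ↦
      ((Module.finBasis ℝ E).coord i).toContinuousLinearMap
        ((trivializationAt E (TangentSpace I : M → Type _) p.proj) q).2) p :=
    (((Module.finBasis ℝ E).coord i).toContinuousLinearMap.contMDiff.contMDiffAt).comp p
      (smoothAt_trivializationAt_snd (mem_frameSet _))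
  have h2 (i : FIdx E) : SmoothFunAt I (fun z ↦ g z (frame I p.proj i z) (W z)) p.proj :=
    hg.smooth (frame_smoothAt (mem_frameSet _) i) hW
  refine (contMDiffAt_finsetSum (t := Finset.univ)
    fun i _ ↦ (h1 i).mul (h2 i).comp_proj).congr_of_eventuallyEq ?_
  filter_upwards [(tendsto_proj p).eventually (frameSet_mem_nhds (I := I) p.proj)] with q hq
  unfold hat
  conv_lhs => rw [← sum_coframe_smul_frame hq q.snd, hg.sum_left]
  refine Finset.sum_congr rfl fun i _ ↦ ?_
  rw [hg.smul_left, coframe_eq_repr hq]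
  rfl

lemma hat_smoothNear {W : VField I M} {p : TangentBundle I M} (hW : SmoothNear W p.proj) :
    SmoothFunNear I.tangent (hat g W) p :=
  ((tendsto_proj p).eventually hW).mono fun _ hq ↦ hg.hat_smoothAt hq

end IsMetric

/-! ### Vertical lifts -/

lemma mdifferentiableAt_fibre (x : M) (w : E) :
    MDifferentiableAt 𝓘(ℝ, E) I.tangent (fun w : E ↦ (⟨x, w⟩ : TangentBundle I M)) w := by
  set e := trivializationAt E (TangentSpace I : M → Type _) x
  have hx : x ∈ e.baseSet := mem_frameSet x
  have h : ContMDiffAt 𝓘(ℝ, E) I.tangent ∞ (fun w : E ↦ (⟨x, w⟩ : TangentBundle I M)) w := by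
    refine (Trivialization.contMDiffAt_iff (e := e) (e.mem_source.2 hx)).2
      ⟨contMDiffAt_const, ?_⟩
    let A : E →L[ℝ] E := e.continuousLinearMapAt ℝ x
    have : ContMDiffAt 𝓘(ℝ, E) 𝓘(ℝ, E) ∞ A w := A.contMDiff.contMDiffAt
    refine this.congr_of_eventuallyEq (Eventually.of_forall fun v ↦ ?_)
    exact (Trivialization.continuousLinearMapAt_apply_of_mem ℝ e hx v).symm
  exact h.mdifferentiableAt (by simp)

lemma verLiftAt_add (p : TangentBundle I M) (u v : TangentSpace I p.proj) :
    verLiftAt p (u + v) = verLiftAt p u + verLiftAt p v :=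
  map_add (mfderiv 𝓘(ℝ, E) I.tangent (fun w : E ↦ (⟨p.proj, w⟩ : TangentBundle I M)) p.snd) u v

lemma verLiftAt_smul (p : TangentBundle I M) (r : ℝ) (v : TangentSpace I p.proj) :
    verLiftAt p (r • v) = r • verLiftAt p v :=
  map_smul (mfderiv 𝓘(ℝ, E) I.tangent (fun w : E ↦ (⟨p.proj, w⟩ : TangentBundle I M)) p.snd) r v

lemma vderiv_verLiftAt_eq (x : M) (y v : E) {F : TangentBundle I M → ℝ}
    (hF : SmoothFunAt I.tangent F ⟨x, y⟩) :
    vderiv F (verLiftAt (⟨x, y⟩ : TangentBundle I M) v)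
      = fderiv ℝ (fun w : E ↦ F ⟨x, w⟩) y v := by
  have h := HasMFDerivAt.comp (x := y) (f := fun w : E ↦ (⟨x, w⟩ : TangentBundle I M))
    (g := F) hF.mdiff.hasMFDerivAt (mdifferentiableAt_fibre x y).hasMFDerivAt
  have h' := h.mfderiv
  rw [mfderiv_eq_fderiv] at h'
  exact (congrArg (fun T : E →L[ℝ] ℝ ↦ T v) h').symm

lemma vderiv_proj_verLiftAt {p : TangentBundle I M} (v : TangentSpace I p.proj)
    {f : M → ℝ} (hf : SmoothFunAt I f p.proj) :
    vderiv (fun q : TangentBundle I M ↦ f q.proj) (verLiftAt p v) = 0 := by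
  obtain ⟨x, y⟩ := p
  have h := vderiv_verLiftAt_eq (I := I) (E := E) x y v
    (F := fun q : TangentBundle I M ↦ f q.proj) (SmoothFunAt.comp_proj hf)
  refine h.trans ?_
  exact congrArg (fun T : E →L[ℝ] ℝ ↦ T v) (fderiv_const_apply (E := E) (x := y) (f x))

lemma IsMetric.vderiv_hat_verLiftAt {g : MetricField I M} (hg : IsMetric g) {p : TangentBundle I M}
    (v : TangentSpace I p.proj) {W : VField I M} (hW : SmoothAt W p.proj) :
    vderiv (hat g W) (verLiftAt p v) = g p.proj v (W p.proj) := by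
  obtain ⟨x, y⟩ := p
  have h := vderiv_verLiftAt_eq (I := I) (E := E) x y v (hg.hat_smoothAt hW)
  refine h.trans ?_
  let ℓ : E →ₗ[ℝ] ℝ :=
    { toFun := fun w ↦ g x w (W x)
      map_add' := fun u v ↦ hg.add_left _ u v _
      map_smul' := fun r v ↦ hg.smul_left _ r v _ }
  exact congrArg (fun T : E →L[ℝ] ℝ ↦ T v) (ℓ.toContinuousLinearMap.fderiv (x := y))

/-! ### Horizontal lifts -/

lemma vderiv_comp_section {x : M} {S : VField I M} (hS : SmoothAt S x) (v : TangentSpace I x)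
    {F : TangentBundle I M → ℝ} (hF : SmoothFunAt I.tangent F ⟨x, S x⟩) :
    vderiv F (x := (⟨x, S x⟩ : TangentBundle I M))
      (mfderiv I I.tangent (fun z ↦ (⟨z, S z⟩ : TangentBundle I M)) x v)
      = vderiv (fun z ↦ F ⟨z, S z⟩) v := by
  have h := HasMFDerivAt.comp (x := x) (f := fun z ↦ (⟨z, S z⟩ : TangentBundle I M))
    (g := F) hF.mdiff.hasMFDerivAt hS.mdiff.hasMFDerivAt
  exact (congrArg (fun T : TangentSpace I x →L[ℝ] ℝ ↦ T v) h.mfderiv).symm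

/-- The image of `v` under the derivative of the local section `extField p.snd`. -/
def sectionLift (p : TangentBundle I M) (v : TangentSpace I p.proj) : TangentSpace I.tangent p :=
  mfderiv I I.tangent (fun z ↦ (⟨z, extField p.snd z⟩ : TangentBundle I M)) p.proj v

lemma horLiftAt_eq (g : MetricField I M) (p : TangentBundle I M) (v : TangentSpace I p.proj) :
    horLiftAt g p v = sectionLift p v
        - verLiftAt p (leviCivita g (extField v) (extField p.snd) p.proj) := rfl

lemma vderiv_sectionLift {p : TangentBundle I M} (v : TangentSpace I p.proj)
    {F : TangentBundle I M → ℝ} (hF : SmoothFunAt I.tangent F p) :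
    vderiv F (sectionLift p v) = vderiv (fun z ↦ F ⟨z, extField p.snd z⟩) v := by
  have he : (⟨p.proj, extField p.snd p.proj⟩ : TangentBundle I M) = p := by
    rw [extField_self]
  have := vderiv_comp_section (extField_smoothNear p.snd).smoothAt v (F := F) (by rwa [he])
  rw [← this]
  unfold vderiv sectionLift
  congr 1
  exact congrArg (fun q ↦ (show E × E →L[ℝ] ℝ from mfderiv I.tangent 𝓘(ℝ, ℝ) F q)) he.symm

lemma vderiv_proj_horLiftAt (g : MetricField I M) {p : TangentBundle I M}
    (v : TangentSpace I p.proj) {f : M → ℝ} (hf : SmoothFunAt I f p.proj) :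
    vderiv (fun q : TangentBundle I M ↦ f q.proj) (horLiftAt g p v) = vderiv f v := by
  rw [horLiftAt_eq, vderiv_vsub, vderiv_proj_verLiftAt _ hf, sub_zero,
    vderiv_sectionLift v hf.comp_proj]

namespace IsMetric

variable {g : MetricField I M} (hg : IsMetric g)
include hg

lemma vderiv_hat_horLiftAt {p : TangentBundle I M} (v : TangentSpace I p.proj)
    {W : VField I M} (hW : SmoothAt W p.proj) :
    vderiv (hat g W) (horLiftAt g p v)
      = g p.proj p.snd (leviCivita g (extField v) W p.proj) := by
  rw [horLiftAt_eq, vderiv_vsub, hg.vderiv_hat_verLiftAt _ hW,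
    vderiv_sectionLift v (hg.hat_smoothAt hW)]
  have h := hg.dirDeriv_inner (extField_smoothNear v).smoothAt
    (extField_smoothNear p.snd).smoothAt hW
  rw [dirDeriv_eq_vderiv, extField_self, extField_self] at h
  unfold hat
  rw [h]
  ring

lemma dirDeriv_hat_horLift {p : TangentBundle I M} {X W : VField I M} (hX : SmoothAt X p.proj)
    (hW : SmoothAt W p.proj) :
    dirDeriv (horLift g X) (hat g W) p = hat g (leviCivita g X W) p := by
  rw [dirDeriv_eq_vderiv, horLift, hg.vderiv_hat_horLiftAt _ hW, hat,
    hg.leviCivita_pointwise (extField_smoothNear _).smoothAt hX hW (extField_self _)]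

/-! ### Functions that detect vectors on the tangent bundle -/

lemma exists_coord (p : TangentBundle I M) (L : E × E →L[ℝ] ℝ) :
    ∃ (f : M → ℝ) (W : VField I M), SmoothFunNear I f p.proj ∧ SmoothNear W p.proj ∧
      (fun q ↦ L (extChartAt I.tangent p q)) =ᶠ[𝓝 p] fun q ↦ f q.proj + hat g W q := by
  set e := trivializationAt E (TangentSpace I : M → Type _) p.proj with he
  let L₁ : E →L[ℝ] ℝ := L.comp (ContinuousLinearMap.inl ℝ E E)
  let L₂ : E →L[ℝ] ℝ := L.comp (ContinuousLinearMap.inr ℝ E E)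
  have hW' (z : M) : ∃ v : TangentSpace I z, ∀ w, g z v w = L₂ (e.continuousLinearMapAt ℝ z w) :=
    hg.exists_repr (L₂.toLinearMap.comp (e.continuousLinearMapAt ℝ z).toLinearMap)
  choose W hW using hW'
  have hWs : ∀ z ∈ frameSet I p.proj, SmoothAt W z := by
    intro z hz
    refine hg.smoothAt_of_inner fun Z hZ ↦ ?_
    have h1 : ContMDiffAt I 𝓘(ℝ, E) ∞ (fun y ↦ (e ⟨y, Z y⟩).2) z :=
      (e.contMDiffAt_section_iff hz).1 hZ.smoothAt
    refine ((L₂.contMDiff.contMDiffAt).comp z h1).congr_of_eventuallyEq ?_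
    filter_upwards [(isOpen_frameSet p.proj).mem_nhds hz] with y hy
    rw [hW, Trivialization.continuousLinearMapAt_apply_of_mem ℝ e hy]
    rfl
  refine ⟨fun z ↦ L₁ (extChartAt I p.proj z), W, ?_,
    eventually_of_mem (frameSet_mem_nhds p.proj) hWs, ?_⟩
  · filter_upwards [frameSet_mem_nhds (I := I) p.proj] with z hz
    exact (L₁.contMDiff.contMDiffAt).comp z (contMDiffAt_extChartAt' hz)
  · filter_upwards [(tendsto_proj p).eventually (frameSet_mem_nhds (I := I) p.proj)] with q hq
    have h1 : extChartAt I.tangent p q = (extChartAt I p.proj q.proj, (e q).2) := by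
      rw [FiberBundle.extChartAt]
      simp only [PartialEquiv.coe_trans, Function.comp_apply, OpenPartialHomeomorph.toFun_eq_coe]
      exact Prod.ext (by simp) rfl
    rw [hat, hg.symm, hW, Trivialization.continuousLinearMapAt_apply_of_mem ℝ e hq, h1]
    change _ = L (_, 0) + L (0, _)
    rw [← map_add]
    simp

/-- Tangent vectors to `TM` are separated by the functions `f ∘ π` and `hat g W`. -/
lemma eq_of_vderiv {p : TangentBundle I M} {ξ η : TangentSpace I.tangent p}
    (h1 : ∀ f : M → ℝ, SmoothFunNear I f p.proj →
      vderiv (fun q : TangentBundle I M ↦ f q.proj) ξ = vderiv (fun q ↦ f q.proj) η)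
    (h2 : ∀ W : VField I M, SmoothNear W p.proj → vderiv (hat g W) ξ = vderiv (hat g W) η) :
    ξ = η := by
  refine eq_of_mfderiv_coord_eq (mem_frameSet p) fun L ↦ ?_
  obtain ⟨f, W, hf, hW, hfW⟩ := hg.exists_coord p L
  have key (ζ : TangentSpace I.tangent p) : vderiv (fun q ↦ L (extChartAt I.tangent p q)) ζ
      = vderiv (fun q : TangentBundle I M ↦ f q.proj) ζ + vderiv (hat g W) ζ := by
    have h3 := dirDeriv_congr (X := extField ζ) hfW
    rw [dirDeriv_add _ hf.comp_proj.self_of_nhds (hg.hat_smoothNear hW).self_of_nhds] at h3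
    simpa only [dirDeriv_eq_vderiv, extField_self] using h3
  refine (key ξ).trans (Eq.trans ?_ (key η).symm)
  rw [h1 f hf, h2 W hW]

/-- Vector fields on `TM` are smooth if their values on `f ∘ π` and `hat g W` are smooth. -/
lemma smoothAt_of_dirDeriv_lift {ξ : VField I.tangent (TangentBundle I M)} {p : TangentBundle I M}
    (h1 : ∀ f : M → ℝ, SmoothFunNear I f p.proj →
      SmoothFunAt I.tangent (dirDeriv ξ (fun q ↦ f q.proj)) p)
    (h2 : ∀ W : VField I M, SmoothNear W p.proj →
      SmoothFunAt I.tangent (dirDeriv ξ (hat g W)) p) :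
    SmoothAt ξ p := by
  refine smoothAt_of_dirDeriv fun L ↦ ?_
  obtain ⟨f, W, hf, hW, hfW⟩ := hg.exists_coord p L
  refine ((h1 f hf).add (h2 W hW)).congr_of_eventuallyEq ?_
  filter_upwards [hfW.eventuallyEq_nhds, hf.comp_proj, hg.hat_smoothNear hW] with q h h' h''
  rw [dirDeriv_congr h, dirDeriv_add _ h' h'']
  rfl

lemma verLift_smoothAt {X : VField I M} {p : TangentBundle I M} (hX : SmoothNear X p.proj) :
    SmoothAt (verLift X) p := by
  refine hg.smoothAt_of_dirDeriv_lift (fun f hf ↦ ?_) fun W hW ↦ ?_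
  · refine (contMDiffAt_const (c := (0 : ℝ))).congr_of_eventuallyEq ?_
    filter_upwards [(tendsto_proj p).eventually hf] with q hq using vderiv_proj_verLiftAt _ hq
  · refine (SmoothFunAt.comp_proj (hg.smooth hX.smoothAt hW.smoothAt)).congr_of_eventuallyEq ?_
    filter_upwards [(tendsto_proj p).eventually hW] with q hq using hg.vderiv_hat_verLiftAt _ hq

lemma horLift_smoothAt {X : VField I M} {p : TangentBundle I M} (hX : SmoothNear X p.proj) :
    SmoothAt (horLift g X) p := by
  refine hg.smoothAt_of_dirDeriv_lift (fun f hf ↦ ?_) fun W hW ↦ ?_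
  · refine (SmoothFunNear.dirDeriv hX hf).self_of_nhds.comp_proj.congr_of_eventuallyEq ?_
    filter_upwards [(tendsto_proj p).eventually hf] with q hq using vderiv_proj_horLiftAt g _ hq
  · refine (hg.hat_smoothAt (hg.leviCivita_smoothAt hX hW)).congr_of_eventuallyEq ?_
    filter_upwards [(tendsto_proj p).eventually hX, (tendsto_proj p).eventually hW] with q hq hq'
      using hg.dirDeriv_hat_horLift hq hq'

lemma verLift_smoothNear {X : VField I M} {p : TangentBundle I M} (hX : SmoothNear X p.proj) :
    SmoothNear (verLift X) p :=
  ((tendsto_proj p).eventually hX.eventually).mono fun _ hq ↦ hg.verLift_smoothAt hq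

lemma horLift_smoothNear {X : VField I M} {p : TangentBundle I M} (hX : SmoothNear X p.proj) :
    SmoothNear (horLift g X) p :=
  ((tendsto_proj p).eventually hX.eventually).mono fun _ hq ↦ hg.horLift_smoothAt hq

/-! ### The splitting into horizontal and vertical parts -/

lemma horLiftAt_add (p : TangentBundle I M) (u v : TangentSpace I p.proj) :
    horLiftAt g p (u + v) = horLiftAt g p u + horLiftAt g p v := by
  refine hg.eq_of_vderiv (fun f hf ↦ ?_) fun W hW ↦ ?_
  · rw [vderiv_vadd]
    simp only [vderiv_proj_horLiftAt g _ hf.self_of_nhds, vderiv_vadd]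
  · rw [vderiv_vadd]
    simp only [hg.vderiv_hat_horLiftAt _ hW.smoothAt]
    rw [← hg.add_right]
    congr 1
    exact ((hg.leviCivita_tensorial hW.smoothAt).toLinearMap (pure_le_nhds _)).map_add u v

lemma horLiftAt_smul (p : TangentBundle I M) (r : ℝ) (v : TangentSpace I p.proj) :
    horLiftAt g p (r • v) = r • horLiftAt g p v := by
  refine hg.eq_of_vderiv (fun f hf ↦ ?_) fun W hW ↦ ?_
  · rw [vderiv_vsmul]
    simp only [vderiv_proj_horLiftAt g _ hf.self_of_nhds, vderiv_vsmul]
  · rw [vderiv_vsmul]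
    simp only [hg.vderiv_hat_horLiftAt _ hW.smoothAt]
    rw [← hg.smul_right]
    congr 1
    exact ((hg.leviCivita_tensorial hW.smoothAt).toLinearMap (pure_le_nhds _)).map_smul r v

lemma verLiftAt_injective (p : TangentBundle I M) :
    Function.Injective (verLiftAt p) := by
  intro u v huv
  refine hg.ext_field fun W hW ↦ ?_
  rw [← hg.vderiv_hat_verLiftAt u hW.smoothAt, ← hg.vderiv_hat_verLiftAt v hW.smoothAt, huv]

end IsMetric

lemma vderiv_horPart {p : TangentBundle I M} (ξ : TangentSpace I.tangent p) {f : M → ℝ}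
    (hf : SmoothFunAt I f p.proj) :
    vderiv f (horPart p ξ) = vderiv (fun q : TangentBundle I M ↦ f q.proj) ξ := by
  have h := HasMFDerivAt.comp (x := p) (f := fun q : TangentBundle I M ↦ q.proj)
    (g := f) hf.mdiff.hasMFDerivAt
    ((smoothAt_proj p).mdifferentiableAt (by simp)).hasMFDerivAt
  exact (congrArg (fun T : TangentSpace I.tangent p →L[ℝ] ℝ ↦ T ξ) h.mfderiv).symm

lemma eq_of_vderiv_base {N : Type*} [TopologicalSpace N] [ChartedSpace H N] [IsManifold I ∞ N]
    {x : N} {u v : TangentSpace I x}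
    (h : ∀ f : N → ℝ, SmoothFunNear I f x → vderiv f u = vderiv f v) : u = v := by
  refine eq_of_mfderiv_coord_eq (mem_frameSet x) fun L ↦ h _ ?_
  filter_upwards [frameSet_mem_nhds (I := I) x] with z hz
  exact (L.contMDiff.contMDiffAt).comp z (contMDiffAt_extChartAt' hz)

lemma horPart_add (p : TangentBundle I M) (ξ η : TangentSpace I.tangent p) :
    horPart p (ξ + η) = horPart p ξ + horPart p η :=
  map_add (mfderiv I.tangent I (fun q : TangentBundle I M ↦ q.proj) p) ξ η

lemma horPart_smul (p : TangentBundle I M) (r : ℝ) (ξ : TangentSpace I.tangent p) :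
    horPart p (r • ξ) = r • horPart p ξ :=
  map_smul (mfderiv I.tangent I (fun q : TangentBundle I M ↦ q.proj) p) r ξ

lemma horPart_horLiftAt (g : MetricField I M) (p : TangentBundle I M)
    (v : TangentSpace I p.proj) : horPart p (horLiftAt g p v) = v :=
  eq_of_vderiv_base fun f hf ↦ by
    rw [vderiv_horPart _ hf.self_of_nhds, vderiv_proj_horLiftAt g _ hf.self_of_nhds]

lemma horPart_verLiftAt (p : TangentBundle I M) (v : TangentSpace I p.proj) :
    horPart p (verLiftAt p v) = 0 :=
  eq_of_vderiv_base fun f hf ↦ by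
    rw [vderiv_horPart _ hf.self_of_nhds, vderiv_proj_verLiftAt _ hf.self_of_nhds]
    exact (map_zero (mfderiv I 𝓘(ℝ, ℝ) f p.proj)).symm

namespace IsMetric

variable {g : MetricField I M} (hg : IsMetric g)
include hg

lemma exists_eq_horLiftAt_add_verLiftAt (p : TangentBundle I M) (ξ : TangentSpace I.tangent p) :
    ∃ u w : TangentSpace I p.proj, ξ = horLiftAt g p u + verLiftAt p w := by
  let Λ : (TangentSpace I p.proj × TangentSpace I p.proj) →ₗ[ℝ] TangentSpace I.tangent p :=
    { toFun := fun a ↦ horLiftAt g p a.1 + verLiftAt p a.2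
      map_add' := fun a b ↦ by
        simp only [Prod.fst_add, Prod.snd_add, hg.horLiftAt_add, verLiftAt_add]; abel
      map_smul' := fun r a ↦ by
        simp only [Prod.smul_fst, Prod.smul_snd, hg.horLiftAt_smul, verLiftAt_smul,
          RingHom.id_apply, smul_add] }
  have hΛ : Function.Injective Λ := by
    refine (injective_iff_map_eq_zero Λ).2 fun a ha ↦ ?_
    have ha' : horLiftAt g p a.1 + verLiftAt p a.2 = 0 := ha
    have h1 : a.1 = 0 := by
      have := congrArg (horPart p) ha'
      rw [horPart_add, horPart_horLiftAt, horPart_verLiftAt, add_zero] at this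
      rw [this]
      exact map_zero (mfderiv I.tangent I (fun q : TangentBundle I M ↦ q.proj) p)
    have h0 : horLiftAt g p 0 = 0 := by simpa using hg.horLiftAt_smul p 0 0
    have h0' : verLiftAt p 0 = 0 := by simpa using verLiftAt_smul p 0 0
    rw [h1, h0, zero_add, ← h0'] at ha'
    exact Prod.ext h1 (hg.verLiftAt_injective p ha')
  have : FiniteDimensional ℝ (TangentSpace I p.proj) := inferInstanceAs (FiniteDimensional ℝ E)
  have : FiniteDimensional ℝ (TangentSpace I.tangent p) :=
    inferInstanceAs (FiniteDimensional ℝ (E × E))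
  obtain ⟨a, ha⟩ := (LinearMap.injective_iff_surjective_of_finrank_eq_finrank
    (rfl : Module.finrank ℝ (E × E) = Module.finrank ℝ (E × E))).1 hΛ ξ
  exact ⟨a.1, a.2, ha.symm⟩

lemma verPart_lifts (p : TangentBundle I M) (u w : TangentSpace I p.proj) :
    verPart g p (horLiftAt g p u + verLiftAt p w) = w := by
  unfold verPart
  rw [horPart_add, horPart_horLiftAt, horPart_verLiftAt, add_zero, add_sub_cancel_left]
  exact Function.leftInverse_invFun (hg.verLiftAt_injective p) w

lemma horPart_lifts (p : TangentBundle I M) (u w : TangentSpace I p.proj) :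
    horPart p (horLiftAt g p u + verLiftAt p w) = u := by
  rw [horPart_add, horPart_horLiftAt, horPart_verLiftAt, add_zero]

lemma lifts_eq (p : TangentBundle I M) (ξ : TangentSpace I.tangent p) :
    horLiftAt g p (horPart p ξ) + verLiftAt p (verPart g p ξ) = ξ := by
  obtain ⟨u, w, rfl⟩ := hg.exists_eq_horLiftAt_add_verLiftAt p ξ
  rw [hg.horPart_lifts, hg.verPart_lifts]

lemma verPart_add (p : TangentBundle I M) (ξ η : TangentSpace I.tangent p) :
    verPart g p (ξ + η) = verPart g p ξ + verPart g p η := by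
  obtain ⟨u, w, rfl⟩ := hg.exists_eq_horLiftAt_add_verLiftAt p ξ
  obtain ⟨u', w', rfl⟩ := hg.exists_eq_horLiftAt_add_verLiftAt p η
  rw [add_add_add_comm, ← hg.horLiftAt_add, ← verLiftAt_add]
  simp only [hg.verPart_lifts]

lemma verPart_smul (p : TangentBundle I M) (r : ℝ) (ξ : TangentSpace I.tangent p) :
    verPart g p (r • ξ) = r • verPart g p ξ := by
  obtain ⟨u, w, rfl⟩ := hg.exists_eq_horLiftAt_add_verLiftAt p ξ
  rw [smul_add, ← hg.horLiftAt_smul, ← verLiftAt_smul]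
  simp only [hg.verPart_lifts]

end IsMetric

end Lifts

section NaturalMetric

variable {E : Type*} [NormedAddCommGroup E] [NormedSpace ℝ E]
  {H : Type*} [TopologicalSpace H] {I : ModelWithCorners ℝ E H}
  {M : Type*} [TopologicalSpace M] [ChartedSpace H M] [IsManifold I ∞ M]
  [FiniteDimensional ℝ E]

lemma IsRiemannianMetric.isMetric {g : MetricField I M} (hg : IsRiemannianMetric g) :
    IsMetric g := by
  obtain ⟨g', hg'⟩ := hg
  refine ⟨fun x u v w ↦ ?_, fun x r u v ↦ ?_, fun x u v ↦ ?_, fun x u h ↦ ?_,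
    fun {X Y x} hX hY ↦ ?_⟩
  · simp only [hg', map_add, add_apply]
  · simp only [hg', map_smul, smul_apply, smul_eq_mul]
  · rw [hg', hg', g'.symm]
  · by_contra hu
    have := g'.pos x u hu
    rw [← hg', h] at this
    exact lt_irrefl _ this
  · have h := ContMDiffAt.clm_bundle_apply₂ (E₃ := fun _ : M ↦ ℝ) (F₃ := ℝ) (b := fun z : M ↦ z)
      (ψ := fun z ↦ g'.inner z) (v := X) (w := Y) (g'.contMDiff x) hX hY
    have h2 := (contMDiffAt_totalSpace.1 h).2
    refine h2.congr_of_eventuallyEq (Eventually.of_forall fun z ↦ hg' z _ _)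

namespace IsMetric

variable {g : MetricField I M} (hg : IsMetric g)
include hg

/-- The metric duals of the local coframe. -/
lemma exists_dualFrame (x : M) : ∃ W : FIdx E → VField I M, (∀ k, SmoothNear (W k) x) ∧
    ∀ z ∈ frameSet I x, ∀ k v, g z v (W k z) = coframe I x k z v := by
  choose W hW using fun (k : FIdx E) (z : M) ↦ hg.exists_repr (x := z) (coframe I x k z)
  refine ⟨W, fun k ↦ eventually_of_mem (frameSet_mem_nhds (I := I) x) fun z hz ↦ ?_,
    fun z _ k v ↦ by rw [hg.symm, hW]⟩
  refine hg.smoothAt_of_inner fun Z hZ ↦ ?_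
  simp only [hW]
  exact coframe_smoothAt hz k hZ.smoothAt

lemma gNatural_lifts (a b c : ℝ) (p : TangentBundle I M) (u w u' w' : TangentSpace I p.proj) :
    gNatural g a b c p (horLiftAt g p u + verLiftAt p w) (horLiftAt g p u' + verLiftAt p w')
      = (a + c) * g p.proj u u' + b * (g p.proj u w' + g p.proj w u') + a * g p.proj w w' := by
  unfold gNatural sasakiLift horizontalLift verticalLift
  rw [hg.horPart_lifts, hg.horPart_lifts, hg.verPart_lifts, hg.verPart_lifts]
  ring

lemma coframe_horPart {x : M} {q : TangentBundle I M} (hq : q.proj ∈ frameSet I x) (k : FIdx E)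
    (ξ : TangentSpace I.tangent q) :
    coframe I x k q.proj (horPart q ξ) = vderiv (fun r : TangentBundle I M ↦
      ((Module.finBasis ℝ E).coord k).toContinuousLinearMap (extChartAt I x r.proj)) ξ := by
  have hf : SmoothFunAt I (fun z : M ↦
      ((Module.finBasis ℝ E).coord k).toContinuousLinearMap (extChartAt I x z)) q.proj :=
    (((Module.finBasis ℝ E).coord k).toContinuousLinearMap.contMDiff.contMDiffAt).comp _
      (contMDiffAt_extChartAt' hq)
  rw [← vderiv_horPart ξ hf, coframe_eq_repr hq]
  exact (mfderiv_clm_comp_extChartAt hq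
    ((Module.finBasis ℝ E).coord k).toContinuousLinearMap (horPart q ξ)).symm

lemma vderiv_hat {p : TangentBundle I M} (ξ : TangentSpace I.tangent p) {W : VField I M}
    (hW : SmoothAt W p.proj) :
    vderiv (hat g W) ξ = g p.proj p.snd (leviCivita g (extField (horPart p ξ)) W p.proj)
      + g p.proj (verPart g p ξ) (W p.proj) := by
  conv_lhs => rw [← hg.lifts_eq p ξ]
  rw [vderiv_vadd, hg.vderiv_hat_horLiftAt _ hW, hg.vderiv_hat_verLiftAt _ hW]

/-- The horizontal and vertical parts of a smooth field have smooth components. -/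
lemma exists_components {ξ : VField I.tangent (TangentBundle I M)} {p : TangentBundle I M}
    (hξ : SmoothAt ξ p) : ∃ A B : FIdx E → TangentBundle I M → ℝ,
      (∀ k, SmoothFunAt I.tangent (A k) p) ∧ (∀ k, SmoothFunAt I.tangent (B k) p) ∧
      ∀ᶠ q in 𝓝 p, horPart q (ξ q) = ∑ k, A k q • frame I p.proj k q.proj ∧
        verPart g q (ξ q) = ∑ k, B k q • frame I p.proj k q.proj := by
  obtain ⟨W, hWs, hW⟩ := hg.exists_dualFrame p.proj
  let φ (k : FIdx E) (r : TangentBundle I M) : ℝ :=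
    ((Module.finBasis ℝ E).coord k).toContinuousLinearMap (extChartAt I p.proj r.proj)
  let A (k : FIdx E) : TangentBundle I M → ℝ := dirDeriv ξ (φ k)
  have hA (k) : SmoothFunAt I.tangent (A k) p := by
    refine SmoothFunAt.dirDeriv hξ (SmoothFunAt.comp_proj (f := fun z ↦
      ((Module.finBasis ℝ E).coord k).toContinuousLinearMap (extChartAt I p.proj z)) ?_)
    exact (((Module.finBasis ℝ E).coord k).toContinuousLinearMap.contMDiff.contMDiffAt).comp _
      (contMDiffAt_extChartAt' (mem_frameSet (I := I) _))
  let B (k : FIdx E) (q : TangentBundle I M) : ℝ := dirDeriv ξ (hat g (W k)) q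
    - ∑ j, A j q * hat g (leviCivita g (frame I p.proj j) (W k)) q
  refine ⟨A, B, hA, fun k ↦ ?_, ?_⟩
  · refine ContMDiffAt.sub (SmoothFunAt.dirDeriv hξ (hg.hat_smoothAt (hWs k).smoothAt)) ?_
    exact contMDiffAt_finsetSum fun j _ ↦ (hA j).mul
      (hg.hat_smoothAt (hg.leviCivita_smoothAt (frame_smoothNear _ j) (hWs k)))
  · filter_upwards [(tendsto_proj p).eventually (frameSet_mem_nhds (I := I) p.proj),
      (tendsto_proj p).eventually ((eventually_all).2 hWs)] with q hq hWq
    have hAq (k) : A k q = coframe I p.proj k q.proj (horPart q (ξ q)) :=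
      (coframe_horPart hg hq k _).symm
    have h1 : horPart q (ξ q) = ∑ k, A k q • frame I p.proj k q.proj := by
      simp only [hAq]
      exact (sum_coframe_smul_frame hq _).symm
    refine ⟨h1, ?_⟩
    have hBq (k) : B k q = coframe I p.proj k q.proj (verPart g q (ξ q)) := by
      have e1 : leviCivita g (extField (horPart q (ξ q))) (W k) q.proj
          = ∑ j, A j q • leviCivita g (frame I p.proj j) (W k) q.proj := by
        let Λ := (hg.leviCivita_tensorial (hWq k)).toLinearMap (pure_le_nhds _)
        have e2 : Λ (horPart q (ξ q)) = ∑ j, A j q • Λ (frame I p.proj j q.proj) := by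
          conv_lhs => rw [h1]
          rw [map_sum]
          exact Finset.sum_congr rfl fun j _ ↦ map_smul Λ _ _
        refine e2.trans (Finset.sum_congr rfl fun j _ ↦ congrArg (A j q • ·) ?_)
        exact hg.leviCivita_pointwise (extField_smoothNear _).smoothAt (frame_smoothAt hq j) (hWq k)
          (extField_self _)
      change vderiv (hat g (W k)) (ξ q) - _ = _
      rw [hg.vderiv_hat _ (hWq k), e1, hg.sum_right, hW _ hq]
      simp only [hg.smul_right]
      exact add_sub_cancel_left _ _
    simp only [hBq]
    exact (sum_coframe_smul_frame hq _).symm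

lemma smoothAt_inner_components {p : TangentBundle I M} {A B : FIdx E → TangentBundle I M → ℝ}
    (hA : ∀ k, SmoothFunAt I.tangent (A k) p) (hB : ∀ k, SmoothFunAt I.tangent (B k) p) :
    SmoothFunAt I.tangent (fun q : TangentBundle I M ↦
      g q.proj (∑ k, A k q • frame I p.proj k q.proj)
        (∑ k, B k q • frame I p.proj k q.proj)) p := by
  simp only [hg.sum_left, hg.sum_right, hg.smul_left, hg.smul_right]
  exact contMDiffAt_finsetSum fun i _ ↦ contMDiffAt_finsetSum fun j _ ↦ (hA i).mul ((hB j).mul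
    (SmoothFunAt.comp_proj (hg.smooth (frame_smoothAt (mem_frameSet _) i)
      (frame_smoothAt (mem_frameSet _) j))))

lemma gNatural_isMetric {a b c : ℝ} (ha : 0 < a) (hα : 0 < a * (a + c) - b ^ 2) :
    IsMetric (gNatural g a b c) := by
  refine ⟨fun p ξ η ζ ↦ ?_, fun p r ξ η ↦ ?_, fun p ξ η ↦ ?_, fun p ξ h ↦ ?_,
    fun {ξ η p} hξ hη ↦ ?_⟩
  · unfold gNatural sasakiLift horizontalLift verticalLift
    rw [horPart_add, hg.verPart_add]
    simp only [hg.add_left]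
    ring
  · unfold gNatural sasakiLift horizontalLift verticalLift
    rw [horPart_smul, hg.verPart_smul]
    simp only [hg.smul_left]
    ring
  · unfold gNatural sasakiLift horizontalLift verticalLift
    rw [hg.symm _ (horPart p ξ) (horPart p η), hg.symm _ (verPart g p ξ) (verPart g p η),
      hg.symm _ (horPart p ξ) (verPart g p η), hg.symm _ (verPart g p ξ) (horPart p η)]
    ring
  · obtain ⟨u, w, rfl⟩ := hg.exists_eq_horLiftAt_add_verLiftAt p ξ
    have h' (u' w') := (hg.gNatural_lifts a b c p u w u' w').symm.trans (h _)
    have hu : u = 0 := by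
      refine hg.nondeg _ _ fun v ↦ ?_
      have h1 := h' v 0
      have h2 := h' 0 v
      simp only [hg.zero_right] at h1 h2
      have : (a * (a + c) - b ^ 2) * g p.proj u v = 0 := by linear_combination a * h1 - b * h2
      exact (mul_eq_zero.1 this).resolve_left hα.ne'
    have hw : w = 0 := by
      refine hg.nondeg _ _ fun v ↦ ?_
      have h2 := h' 0 v
      simp only [hg.zero_right, hu, hg.zero_left] at h2
      have : a * g p.proj w v = 0 := by linear_combination h2
      exact (mul_eq_zero.1 this).resolve_left ha.ne'
    have h0 : horLiftAt g p 0 = 0 := by simpa using hg.horLiftAt_smul p 0 0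
    have h0' : verLiftAt p 0 = 0 := by simpa using verLiftAt_smul p 0 0
    rw [hu, hw, h0, h0', add_zero]
  · obtain ⟨A, B, hA, hB, hAB⟩ := hg.exists_components hξ
    obtain ⟨A', B', hA', hB', hAB'⟩ := hg.exists_components hη
    have s1 := hg.smoothAt_inner_components hA hA'
    have s2 := hg.smoothAt_inner_components hA hB'
    have s3 := hg.smoothAt_inner_components hB hA'
    have s4 := hg.smoothAt_inner_components hB hB'
    refine ((((contMDiffAt_const (c := a)).mul (s1.add s4)).add
      ((contMDiffAt_const (c := b)).mul (s2.add s3))).add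
      ((contMDiffAt_const (c := c)).mul s1)).congr_of_eventuallyEq ?_
    filter_upwards [hAB, hAB'] with q h h'
    unfold gNatural sasakiLift horizontalLift verticalLift
    rw [h.1, h.2, h'.1, h'.2]
    rfl

end IsMetric

end NaturalMetric

section Brackets

variable {E : Type*} [NormedAddCommGroup E] [NormedSpace ℝ E]
  {H : Type*} [TopologicalSpace H] {I : ModelWithCorners ℝ E H}
  {M : Type*} [TopologicalSpace M] [ChartedSpace H M] [IsManifold I ∞ M]
  [FiniteDimensional ℝ E]

lemma dirDeriv_verLift_proj (X : VField I M) {f : M → ℝ} {p : TangentBundle I M}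
    (hf : SmoothFunAt I f p.proj) :
    dirDeriv (verLift X) (fun q : TangentBundle I M ↦ f q.proj) p = 0 :=
  vderiv_proj_verLiftAt _ hf

lemma dirDeriv_horLift_proj (g : MetricField I M) (X : VField I M) {f : M → ℝ}
    {p : TangentBundle I M} (hf : SmoothFunAt I f p.proj) :
    dirDeriv (horLift g X) (fun q : TangentBundle I M ↦ f q.proj) p = dirDeriv X f p.proj :=
  vderiv_proj_horLiftAt g _ hf

lemma verLiftAt_zero (p : TangentBundle I M) : verLiftAt p 0 = 0 := by
  simpa using verLiftAt_smul p 0 0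

namespace IsMetric

variable {g : MetricField I M} (hg : IsMetric g)
include hg

lemma horLiftAt_zero (p : TangentBundle I M) : horLiftAt g p 0 = 0 := by
  simpa using hg.horLiftAt_smul p 0 0

lemma dirDeriv_verLift_hat (X : VField I M) {W : VField I M} {p : TangentBundle I M}
    (hW : SmoothAt W p.proj) :
    dirDeriv (verLift X) (hat g W) p = g p.proj (X p.proj) (W p.proj) :=
  hg.vderiv_hat_verLiftAt _ hW

variable [Nontrivial E]

lemma mlieBracket_horLift_horLift {X Y : VField I M} {p : TangentBundle I M}
    (hX : SmoothNear X p.proj) (hY : SmoothNear Y p.proj) :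
    mlieBracket I.tangent (horLift g X) (horLift g Y) p
      = horLiftAt g p (mlieBracket I X Y p.proj)
        - verLiftAt p (curvatureAt g (X p.proj) (Y p.proj) p.snd) := by
  have hX' := hg.horLift_smoothNear hX
  have hY' := hg.horLift_smoothNear hY
  refine hg.eq_of_vderiv (fun f hf ↦ ?_) fun W hW ↦ ?_
  · rw [← dirDeriv_eq_vderiv, dirDeriv_mlieBracket hX' hY' hf.comp_proj, vderiv_vsub,
      vderiv_proj_horLiftAt g _ hf.self_of_nhds, vderiv_proj_verLiftAt _ hf.self_of_nhds,
      sub_zero, ← dirDeriv_eq_vderiv, dirDeriv_mlieBracket hX hY hf]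
    have key {A B : VField I M} (hB : SmoothNear B p.proj) :
        dirDeriv (horLift g A) (dirDeriv (horLift g B) fun q : TangentBundle I M ↦ f q.proj) p
          = dirDeriv A (dirDeriv B f) p.proj := by
      have h1 : (dirDeriv (horLift g B) fun q : TangentBundle I M ↦ f q.proj) =ᶠ[𝓝 p]
          fun q ↦ dirDeriv B f q.proj := by
        filter_upwards [(tendsto_proj p).eventually hf] with q hq using
          dirDeriv_horLift_proj g B hq
      rw [dirDeriv_congr h1]
      exact dirDeriv_horLift_proj g A (SmoothFunAt.dirDeriv hB.smoothAt hf.self_of_nhds)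
    rw [key hY, key hX]
  · rw [← dirDeriv_eq_vderiv, dirDeriv_mlieBracket hX' hY' (hg.hat_smoothNear hW), vderiv_vsub,
      hg.vderiv_hat_horLiftAt _ hW.smoothAt, hg.vderiv_hat_verLiftAt _ hW.smoothAt]
    have key {A B : VField I M} (hA : SmoothNear A p.proj) (hB : SmoothNear B p.proj) :
        dirDeriv (horLift g A) (dirDeriv (horLift g B) (hat g W)) p
          = g p.proj p.snd (leviCivita g A (leviCivita g B W) p.proj) := by
      have h1 : dirDeriv (horLift g B) (hat g W) =ᶠ[𝓝 p] hat g (leviCivita g B W) := by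
        filter_upwards [(tendsto_proj p).eventually hB, (tendsto_proj p).eventually hW] with q h h'
          using hg.dirDeriv_hat_horLift h h'
      rw [dirDeriv_congr h1, hg.dirDeriv_hat_horLift hA.smoothAt (hg.leviCivita_smoothAt hB hW)]
      rfl
    rw [key hX hY, key hY hX, hg.inner_curvatureAt_skew, ← hg.curvature_eq hX hY hW,
      curvature_apply, hg.leviCivita_pointwise (extField_smoothNear _).smoothAt
        (hX.mlieBracket hY).smoothAt hW.smoothAt (extField_self _)]
    simp only [hg.sub_right]
    ring

lemma mlieBracket_horLift_verLift {X Y : VField I M} {p : TangentBundle I M}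
    (hX : SmoothNear X p.proj) (hY : SmoothNear Y p.proj) :
    mlieBracket I.tangent (horLift g X) (verLift Y) p
      = verLiftAt p (leviCivita g X Y p.proj) := by
  have hX' := hg.horLift_smoothNear hX
  have hY' := hg.verLift_smoothNear hY
  refine hg.eq_of_vderiv (fun f hf ↦ ?_) fun W hW ↦ ?_
  · rw [← dirDeriv_eq_vderiv, dirDeriv_mlieBracket hX' hY' hf.comp_proj,
      vderiv_proj_verLiftAt _ hf.self_of_nhds]
    have h1 : (dirDeriv (verLift Y) fun q : TangentBundle I M ↦ f q.proj) =ᶠ[𝓝 p]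
        fun _ ↦ 0 := by
      filter_upwards [(tendsto_proj p).eventually hf] with q hq using dirDeriv_verLift_proj Y hq
    have h2 : (dirDeriv (horLift g X) fun q : TangentBundle I M ↦ f q.proj) =ᶠ[𝓝 p]
        fun q ↦ dirDeriv X f q.proj := by
      filter_upwards [(tendsto_proj p).eventually hf] with q hq using dirDeriv_horLift_proj g X hq
    rw [dirDeriv_congr h1, dirDeriv_congr h2, dirDeriv_const,
      dirDeriv_verLift_proj Y (SmoothFunAt.dirDeriv hX.smoothAt hf.self_of_nhds), sub_zero]
  · rw [← dirDeriv_eq_vderiv, dirDeriv_mlieBracket hX' hY' (hg.hat_smoothNear hW),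
      hg.vderiv_hat_verLiftAt _ hW.smoothAt]
    have h1 : dirDeriv (verLift Y) (hat g W) =ᶠ[𝓝 p] fun q ↦ g q.proj (Y q.proj) (W q.proj) := by
      filter_upwards [(tendsto_proj p).eventually hW] with q hq using hg.dirDeriv_verLift_hat Y hq
    have h2 : dirDeriv (horLift g X) (hat g W) =ᶠ[𝓝 p] hat g (leviCivita g X W) := by
      filter_upwards [(tendsto_proj p).eventually hX, (tendsto_proj p).eventually hW] with q h h'
        using hg.dirDeriv_hat_horLift h h'
    rw [dirDeriv_congr h1, dirDeriv_congr h2,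
      dirDeriv_horLift_proj g X (f := fun z ↦ g z (Y z) (W z)) (hg.smooth hY.smoothAt hW.smoothAt),
      hg.dirDeriv_verLift_hat Y (hg.leviCivita_smoothAt hX hW),
      hg.dirDeriv_inner hX.smoothAt hY.smoothAt hW.smoothAt]
    ring

lemma mlieBracket_verLift_horLift {X Y : VField I M} {p : TangentBundle I M}
    (hX : SmoothNear X p.proj) (hY : SmoothNear Y p.proj) :
    mlieBracket I.tangent (verLift Y) (horLift g X) p
      = - verLiftAt p (leviCivita g X Y p.proj) := by
  rw [← hg.mlieBracket_horLift_verLift hX hY, mlieBracket_swap_apply]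

lemma mlieBracket_verLift_verLift {X Y : VField I M} {p : TangentBundle I M}
    (hX : SmoothNear X p.proj) (hY : SmoothNear Y p.proj) :
    mlieBracket I.tangent (verLift X) (verLift Y) p = 0 := by
  have hX' := hg.verLift_smoothNear hX
  have hY' := hg.verLift_smoothNear hY
  have z1 (F : TangentBundle I M → ℝ) : vderiv F (0 : TangentSpace I.tangent p) = 0 :=
    map_zero (mfderiv I.tangent 𝓘(ℝ, ℝ) F p)
  refine hg.eq_of_vderiv (fun f hf ↦ ?_) fun W hW ↦ ?_
  · rw [← dirDeriv_eq_vderiv, dirDeriv_mlieBracket hX' hY' hf.comp_proj, z1]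
    have h1 (A : VField I M) : (dirDeriv (verLift A) fun q : TangentBundle I M ↦ f q.proj) =ᶠ[𝓝 p]
        fun _ ↦ 0 := by
      filter_upwards [(tendsto_proj p).eventually hf] with q hq using dirDeriv_verLift_proj A hq
    rw [dirDeriv_congr (h1 X), dirDeriv_congr (h1 Y), dirDeriv_const, dirDeriv_const, sub_zero]
  · rw [← dirDeriv_eq_vderiv, dirDeriv_mlieBracket hX' hY' (hg.hat_smoothNear hW), z1]
    have h1 (A : VField I M) : dirDeriv (verLift A) (hat g W) =ᶠ[𝓝 p]
        fun q ↦ g q.proj (A q.proj) (W q.proj) := by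
      filter_upwards [(tendsto_proj p).eventually hW] with q hq using hg.dirDeriv_verLift_hat A hq
    rw [dirDeriv_congr (h1 X), dirDeriv_congr (h1 Y),
      dirDeriv_verLift_proj Y (f := fun z ↦ g z (X z) (W z)) (hg.smooth hX.smoothAt hW.smoothAt),
      dirDeriv_verLift_proj X (f := fun z ↦ g z (Y z) (W z)) (hg.smooth hY.smoothAt hW.smoothAt),
      sub_zero]

end IsMetric

end Brackets

section Connection

variable {E : Type*} [NormedAddCommGroup E] [NormedSpace ℝ E]
  {H : Type*} [TopologicalSpace H] {I : ModelWithCorners ℝ E H}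
  {M : Type*} [TopologicalSpace M] [ChartedSpace H M] [IsManifold I ∞ M]
  [FiniteDimensional ℝ E]

namespace IsMetric

variable {g : MetricField I M} (hg : IsMetric g) (a b c : ℝ)
include hg

lemma gNatural_hor_hor (p : TangentBundle I M) (u v : TangentSpace I p.proj) :
    gNatural g a b c p (horLiftAt g p u) (horLiftAt g p v) = (a + c) * g p.proj u v := by
  have := hg.gNatural_lifts a b c p u 0 v 0
  simpa only [verLiftAt_zero, add_zero, hg.zero_left, hg.zero_right, mul_zero] using this

lemma gNatural_hor_ver (p : TangentBundle I M) (u v : TangentSpace I p.proj) :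
    gNatural g a b c p (horLiftAt g p u) (verLiftAt p v) = b * g p.proj u v := by
  have := hg.gNatural_lifts a b c p u 0 0 v
  simpa only [verLiftAt_zero, hg.horLiftAt_zero, add_zero, zero_add, hg.zero_left, hg.zero_right,
    mul_zero] using this

lemma gNatural_ver_hor (p : TangentBundle I M) (u v : TangentSpace I p.proj) :
    gNatural g a b c p (verLiftAt p u) (horLiftAt g p v) = b * g p.proj u v := by
  have := hg.gNatural_lifts a b c p 0 u v 0
  simpa only [verLiftAt_zero, hg.horLiftAt_zero, add_zero, zero_add, hg.zero_left, hg.zero_right,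
    mul_zero] using this

lemma gNatural_ver_ver (p : TangentBundle I M) (u v : TangentSpace I p.proj) :
    gNatural g a b c p (verLiftAt p u) (verLiftAt p v) = a * g p.proj u v := by
  have := hg.gNatural_lifts a b c p 0 u 0 v
  simpa only [verLiftAt_zero, hg.horLiftAt_zero, add_zero, zero_add, hg.zero_left, hg.zero_right,
    mul_zero] using this

lemma dirDeriv_horLift_const_mul (r : ℝ) (X : VField I M) {Y Z : VField I M}
    {p : TangentBundle I M} (hY : SmoothAt Y p.proj) (hZ : SmoothAt Z p.proj) :
    dirDeriv (horLift g X) (fun q : TangentBundle I M ↦ r * g q.proj (Y q.proj) (Z q.proj)) p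
      = r * dirDeriv X (fun z ↦ g z (Y z) (Z z)) p.proj := by
  have h := hg.smooth hY hZ
  rw [dirDeriv_const_mul _ r (SmoothFunAt.comp_proj (f := fun z ↦ g z (Y z) (Z z)) h),
    dirDeriv_horLift_proj g X h]

lemma dirDeriv_verLift_const_mul (r : ℝ) (X : VField I M) {Y Z : VField I M}
    {p : TangentBundle I M} (hY : SmoothAt Y p.proj) (hZ : SmoothAt Z p.proj) :
    dirDeriv (verLift X) (fun q : TangentBundle I M ↦ r * g q.proj (Y q.proj) (Z q.proj)) p
      = 0 := by
  have h := hg.smooth hY hZ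
  rw [dirDeriv_const_mul _ r (SmoothFunAt.comp_proj (f := fun z ↦ g z (Y z) (Z z)) h),
    dirDeriv_verLift_proj X h, mul_zero]

variable {a b c} [Nontrivial E] (ha : 0 < a) (hα : 0 < a * (a + c) - b ^ 2)
include ha hα

/-- A characterization of `∇_ξ η` on `TM` by the lifts of vector fields. -/
lemma leviCivita_gNatural_eq {p : TangentBundle I M} {ξ η : VField I.tangent (TangentBundle I M)}
    (hξ : SmoothAt ξ p) (hη : SmoothAt η p) {u w : TangentSpace I p.proj}
    (hh : ∀ U, SmoothNear U p.proj → 2 * ((a + c) * g p.proj u (U p.proj)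
      + b * g p.proj w (U p.proj)) = koszul (gNatural g a b c) ξ η (horLift g U) p)
    (hv : ∀ S, SmoothNear S p.proj → 2 * (b * g p.proj u (S p.proj)
      + a * g p.proj w (S p.proj)) = koszul (gNatural g a b c) ξ η (verLift S) p) :
    leviCivita (gNatural g a b c) ξ η p = horLiftAt g p u + verLiftAt p w := by
  have hG := hg.gNatural_isMetric ha hα
  refine hG.leviCivita_eq_of_koszul hξ hη fun ζ ↦ ?_
  obtain ⟨u', w', rfl⟩ := hg.exists_eq_horLiftAt_add_verLiftAt p ζ
  have hU := extField_smoothNear u'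
  have hS := extField_smoothNear w'
  have hU' := (hg.horLift_smoothAt hU : SmoothAt _ p)
  have hS' := (hg.verLift_smoothAt hS : SmoothAt _ p)
  refine ⟨horLift g (extField u') + verLift (extField w'), hU'.add hS', ?_, ?_⟩
  · rw [Pi.add_apply, horLift, verLift, extField_self, extField_self]
  · rw [(hG.koszul_tensorial hξ hη).add (eventually_pure.2 hU') (eventually_pure.2 hS'),
      ← hh _ hU, ← hv _ hS, extField_self, extField_self, hg.gNatural_lifts]
    ring

end IsMetric

end Connection

section LiftConnection

variable {E : Type*} [NormedAddCommGroup E] [NormedSpace ℝ E]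
  {H : Type*} [TopologicalSpace H] {I : ModelWithCorners ℝ E H}
  {M : Type*} [TopologicalSpace M] [ChartedSpace H M] [IsManifold I ∞ M]
  [FiniteDimensional ℝ E]

namespace IsMetric

variable {g : MetricField I M} (hg : IsMetric g) {a b c α : ℝ} [Nontrivial E] (ha : 0 < a)
  (hα : α = a * (a + c) - b ^ 2) (hαpos : 0 < α)
  {X Y : VField I M} {p : TangentBundle I M} (hX : SmoothNear X p.proj) (hY : SmoothNear Y p.proj)
include hg ha hα hαpos hX hY

lemma leviCivita_verLift_verLift :
    leviCivita (gNatural g a b c) (verLift X) (verLift Y) p = 0 := by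
  have hG := hg.gNatural_isMetric ha (hα ▸ hαpos)
  have h := hg.leviCivita_gNatural_eq ha (hα ▸ hαpos) (hg.verLift_smoothAt hX)
    (hg.verLift_smoothAt hY) (u := 0) (w := 0) (fun U hU ↦ ?_) fun S hS ↦ ?_
  · rw [h, hg.horLiftAt_zero, verLiftAt_zero, add_zero]
  · unfold koszul
    rw [hg.mlieBracket_verLift_verLift hX hY, hg.mlieBracket_verLift_horLift hU hX,
      hg.mlieBracket_verLift_horLift hU hY, hG.zero_left, hG.neg_left, hG.neg_left]
    simp only [verLift, horLift, hg.gNatural_ver_ver, hg.gNatural_ver_hor]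
    have e1 := hg.dirDeriv_verLift_const_mul b X hY.smoothAt hU.smoothAt
    have e2 := hg.dirDeriv_verLift_const_mul b Y hX.smoothAt hU.smoothAt
    have e3 := hg.dirDeriv_horLift_const_mul a U hX.smoothAt hY.smoothAt
    rw [e1, e2, e3, hg.dirDeriv_inner hU.smoothAt hX.smoothAt hY.smoothAt, hg.zero_left,
      hg.symm p.proj (leviCivita g U Y p.proj)]
    ring
  · unfold koszul
    rw [hg.mlieBracket_verLift_verLift hX hY, hg.mlieBracket_verLift_verLift hX hS,
      hg.mlieBracket_verLift_verLift hY hS, hG.zero_left, hG.zero_left, hG.zero_left]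
    simp only [verLift, hg.gNatural_ver_ver]
    have e1 := hg.dirDeriv_verLift_const_mul a X hY.smoothAt hS.smoothAt
    have e2 := hg.dirDeriv_verLift_const_mul a Y hX.smoothAt hS.smoothAt
    have e3 := hg.dirDeriv_verLift_const_mul a S hX.smoothAt hY.smoothAt
    rw [e1, e2, e3, hg.zero_left]
    ring

lemma leviCivita_horLift_verLift :
    leviCivita (gNatural g a b c) (horLift g X) (verLift Y) p
      = horLiftAt g p (-(a ^ 2 / (2 * α)) • curvatureAt g (Y p.proj) p.snd (X p.proj))
        + verLiftAt p (leviCivita g X Y p.proj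
          + (a * b / (2 * α)) • curvatureAt g (Y p.proj) p.snd (X p.proj)) := by
  have hG := hg.gNatural_isMetric ha (hα ▸ hαpos)
  have hα0 := hαpos.ne'
  refine hg.leviCivita_gNatural_eq ha (hα ▸ hαpos) (hg.horLift_smoothAt hX)
    (hg.verLift_smoothAt hY) (fun U hU ↦ ?_) fun S hS ↦ ?_
  · unfold koszul
    rw [hg.mlieBracket_horLift_verLift hX hY, hg.mlieBracket_horLift_horLift hX hU,
      hg.mlieBracket_verLift_horLift hU hY, hG.sub_left, hG.neg_left]
    simp only [verLift, horLift, hg.gNatural_ver_ver, hg.gNatural_ver_hor, hg.gNatural_hor_hor,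
      hg.gNatural_hor_ver]
    have e1 := hg.dirDeriv_horLift_const_mul b X hY.smoothAt hU.smoothAt
    have e2 := hg.dirDeriv_verLift_const_mul (a + c) Y hX.smoothAt hU.smoothAt
    have e3 := hg.dirDeriv_horLift_const_mul b U hX.smoothAt hY.smoothAt
    rw [e1, e2, e3, hg.dirDeriv_inner hU.smoothAt hX.smoothAt hY.smoothAt,
      hg.dirDeriv_inner hX.smoothAt hY.smoothAt hU.smoothAt,
      hg.torsion_free hX.smoothAt hU.smoothAt, hg.inner_curvatureAt_pair p.proj _ _ p.snd,
      hg.curvatureAt_swap p.proj p.snd, hg.neg_left, hg.sub_left, hg.add_left, hg.smul_left,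
      hg.smul_left, hg.symm p.proj (leviCivita g U Y p.proj),
      hg.symm p.proj (leviCivita g X U p.proj)]
    field_simp
    rw [hα]
    ring
  · unfold koszul
    rw [hg.mlieBracket_horLift_verLift hX hY, hg.mlieBracket_horLift_verLift hX hS,
      hg.mlieBracket_verLift_verLift hY hS, hG.zero_left]
    simp only [verLift, horLift, hg.gNatural_ver_ver, hg.gNatural_hor_ver]
    have e1 := hg.dirDeriv_horLift_const_mul a X hY.smoothAt hS.smoothAt
    have e2 := hg.dirDeriv_verLift_const_mul b Y hX.smoothAt hS.smoothAt
    have e3 := hg.dirDeriv_verLift_const_mul b S hX.smoothAt hY.smoothAt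
    rw [e1, e2, e3, hg.dirDeriv_inner hX.smoothAt hY.smoothAt hS.smoothAt, hg.add_left,
      hg.smul_left, hg.smul_left, hg.symm p.proj (leviCivita g X S p.proj)]
    field_simp
    ring

lemma leviCivita_horLift_horLift :
    leviCivita (gNatural g a b c) (horLift g X) (horLift g Y) p
      = horLiftAt g p (leviCivita g X Y p.proj
          - (a * b / (2 * α)) • (curvatureAt g (X p.proj) p.snd (Y p.proj)
            + curvatureAt g (Y p.proj) p.snd (X p.proj)))
        + verLiftAt p ((b ^ 2 / α) • curvatureAt g (X p.proj) p.snd (Y p.proj)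
          - (a * (a + c) / (2 * α)) • curvatureAt g (X p.proj) (Y p.proj) p.snd) := by
  have hG := hg.gNatural_isMetric ha (hα ▸ hαpos)
  have hα0 := hαpos.ne'
  have hB : curvatureAt g (X p.proj) p.snd (Y p.proj)
      = curvatureAt g (X p.proj) (Y p.proj) p.snd + curvatureAt g (Y p.proj) p.snd (X p.proj) := by
    have h1 := hg.bianchi p.proj (X p.proj) (Y p.proj) p.snd
    rw [hg.curvatureAt_swap p.proj p.snd] at h1
    linear_combination (norm := module) -h1
  refine hg.leviCivita_gNatural_eq ha (hα ▸ hαpos) (hg.horLift_smoothAt hX)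
    (hg.horLift_smoothAt hY) (fun U hU ↦ ?_) fun S hS ↦ ?_
  · have hk := hg.two_mul_leviCivita hX.smoothAt hY.smoothAt hU.smoothAt
    unfold koszul at hk ⊢
    rw [hg.mlieBracket_horLift_horLift hX hY, hg.mlieBracket_horLift_horLift hX hU,
      hg.mlieBracket_horLift_horLift hY hU, hG.sub_left, hG.sub_left, hG.sub_left]
    simp only [horLift, hg.gNatural_ver_hor, hg.gNatural_hor_hor]
    have e1 := hg.dirDeriv_horLift_const_mul (a + c) X hY.smoothAt hU.smoothAt
    have e2 := hg.dirDeriv_horLift_const_mul (a + c) Y hX.smoothAt hU.smoothAt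
    have e3 := hg.dirDeriv_horLift_const_mul (a + c) U hX.smoothAt hY.smoothAt
    rw [e1, e2, e3, hg.inner_curvatureAt_pair p.proj (X p.proj) (U p.proj) p.snd,
      hg.inner_curvatureAt_pair p.proj (Y p.proj) (U p.proj) p.snd,
      hg.curvatureAt_swap p.proj p.snd, hg.curvatureAt_swap p.proj p.snd (X p.proj), hB]
    simp only [hg.sub_left, hg.add_left, hg.smul_left, hg.neg_left]
    linear_combination (norm := skip) (a + c) * hk
    field_simp
    rw [hα]
    ring
  · unfold koszul
    rw [hg.mlieBracket_horLift_horLift hX hY, hg.mlieBracket_horLift_verLift hX hS,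
      hg.mlieBracket_horLift_verLift hY hS, hG.sub_left]
    simp only [verLift, horLift, hg.gNatural_ver_ver, hg.gNatural_hor_ver, hg.gNatural_ver_hor,
      hg.gNatural_hor_hor]
    have e1 := hg.dirDeriv_horLift_const_mul b X hY.smoothAt hS.smoothAt
    have e2 := hg.dirDeriv_horLift_const_mul b Y hX.smoothAt hS.smoothAt
    have e3 := hg.dirDeriv_verLift_const_mul (a + c) S hX.smoothAt hY.smoothAt
    rw [e1, e2, e3, hg.dirDeriv_inner hX.smoothAt hY.smoothAt hS.smoothAt,
      hg.dirDeriv_inner hY.smoothAt hX.smoothAt hS.smoothAt, hB,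
      hg.torsion_free hX.smoothAt hY.smoothAt, hg.symm p.proj (leviCivita g X S p.proj),
      hg.symm p.proj (leviCivita g Y S p.proj)]
    simp only [hg.sub_left, hg.add_left, hg.smul_left]
    field_simp
    rw [hα]
    ring

end IsMetric

end LiftConnection

section LiftCurvature

variable {E : Type*} [NormedAddCommGroup E] [NormedSpace ℝ E]
  {H : Type*} [TopologicalSpace H] {I : ModelWithCorners ℝ E H}
  {M : Type*} [TopologicalSpace M] [ChartedSpace H M] [IsManifold I ∞ M]
  [FiniteDimensional ℝ E]

/-- The vertical lift as a linear map. -/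
def verLiftLin (p : TangentBundle I M) : TangentSpace I p.proj →ₗ[ℝ] TangentSpace I.tangent p where
  toFun := verLiftAt p
  map_add' := verLiftAt_add p
  map_smul' := verLiftAt_smul p

namespace IsMetric

variable {g : MetricField I M} (hg : IsMetric g)

/-- The horizontal lift as a linear map. -/
def horLiftLin (p : TangentBundle I M) : TangentSpace I p.proj →ₗ[ℝ] TangentSpace I.tangent p where
  toFun := horLiftAt g p
  map_add' := hg.horLiftAt_add p
  map_smul' := hg.horLiftAt_smul p

include hg
variable [Nontrivial E]

/-- The derivative along `X` of the components of `R(A,t)B`, for a parallel argument `t`. -/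
lemma sum_covDeriv_components {x : M} {W : FIdx E → VField I M} (hWs : ∀ k, SmoothNear (W k) x)
    (hW : ∀ z ∈ frameSet I x, ∀ k v, g z v (W k z) = coframe I x k z v)
    {X A B : VField I M} (hX : SmoothNear X x) (hA : SmoothNear A x) (hB : SmoothNear B x)
    (t : TangentSpace I x) :
    ∑ k, (g x t (leviCivita g X (W k) x) • curvature g A (frame I x k) B x
        + g x t (W k x) • leviCivita g X (curvature g A (frame I x k) B) x)
      = covDerivCurvatureAt g (X x) (A x) t (B x) + curvatureAt g (leviCivita g X A x) t (B x)
        + curvatureAt g (A x) t (leviCivita g X B x) := by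
  set S : VField I M := extField t with hS'
  have hS : SmoothNear S x := extField_smoothNear t
  have hSx : S x = t := extField_self t
  have hC (k) : SmoothNear (curvature g A (frame I x k) B) x :=
    hg.curvature_smoothNear hA (frame_smoothNear x k) hB
  have hsum {z : M} (hz : z ∈ frameSet I x) (hAz : SmoothNear A z) (hBz : SmoothNear B z)
      {T : VField I M} (hT : SmoothNear T z) : curvature g A T B z
        = ∑ k, g z (T z) (W k z) • curvature g A (frame I x k) B z := by
    let Λ := (hg.curvature_tensorial₂ hAz hBz).toLinearMap le_rfl
    have e (U : VField I M) (hU : SmoothNear U z) : curvature g A U B z = Λ (U z) :=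
      (hg.curvature_tensorial₂ hAz hBz).pointwise le_rfl hU (extField_smoothNear _)
        (extField_self _).symm
    rw [e T hT, ← sum_coframe_smul_frame hz (T z), map_sum]
    refine Finset.sum_congr rfl fun k _ ↦ ?_
    rw [map_smul, sum_coframe_smul_frame hz (T z), hW z hz,
      e _ (eventually_of_mem ((isOpen_frameSet x).mem_nhds hz) fun y hy ↦ frame_smoothAt hy k)]
  have h1 : GermEq (curvature g A S B)
      (∑ k, (fun z ↦ g z (S z) (W k z)) • curvature g A (frame I x k) B) x := by
    filter_upwards [frameSet_mem_nhds (I := I) x, hA.eventually, hB.eventually, hS.eventually]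
      with z hz hAz hBz hSz
    rw [Finset.sum_apply]
    exact hsum hz hAz hBz hSz
  have hf (k) : SmoothFunAt I (fun z ↦ g z (S z) (W k z)) x :=
    hg.smooth hS.smoothAt (hWs k).smoothAt
  have h2 : leviCivita g X (curvature g A S B) x
      = ∑ k, (g x t (leviCivita g X (W k) x) • curvature g A (frame I x k) B x
        + g x t (W k x) • leviCivita g X (curvature g A (frame I x k) B) x)
        + curvature g A (leviCivita g X S) B x := by
    rw [leviCivita_congr (GermEq.refl X x) h1, hg.leviCivita_sum_right _ hX.smoothAt
      (fun k _ ↦ SmoothAt.smul (hf k) (hC k).smoothAt),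
      hsum (mem_frameSet x) hA hB (hg.leviCivita_smoothNear hX hS), ← Finset.sum_add_distrib]
    refine Finset.sum_congr rfl fun k _ ↦ ?_
    rw [hg.leviCivita_smul_right (hf k) hX.smoothAt (hC k).smoothAt,
      hg.dirDeriv_inner hX.smoothAt hS.smoothAt (hWs k).smoothAt, hSx]
    module
  have h3 := covDerivCurvature_apply g X A S B x
  rw [hg.covDerivCurvature_eq hX hA hS hB, hg.curvature_eq (hg.leviCivita_smoothNear hX hA) hS hB,
    hg.curvature_eq hA hS (hg.leviCivita_smoothNear hX hB), hSx, h2] at h3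
  rw [h3]
  abel

/-- Covariant derivative of a lift of the field `R(A,t)B`, for a lift `ℓ` whose derivatives on
vector fields are known. -/
lemma leviCivita_lift_curvatureAt {G : MetricField I.tangent (TangentBundle I M)} (hG : IsMetric G)
    {p : TangentBundle I M}
    (ℓ : ∀ q : TangentBundle I M, TangentSpace I q.proj →ₗ[ℝ] TangentSpace I.tangent q)
    (hℓ : ∀ C : VField I M, SmoothNear C p.proj → SmoothNear (fun q ↦ ℓ q (C q.proj)) p)
    {X : VField I M} (Θ : TangentSpace I p.proj →ₗ[ℝ] TangentSpace I.tangent p)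
    (hΘ : ∀ C : VField I M, SmoothNear C p.proj →
      leviCivita G (horLift g X) (fun q ↦ ℓ q (C q.proj)) p
        = ℓ p (leviCivita g X C p.proj) + Θ (C p.proj))
    {A B : VField I M} (hX : SmoothNear X p.proj) (hA : SmoothNear A p.proj)
    (hB : SmoothNear B p.proj) :
    SmoothNear (fun q : TangentBundle I M ↦
        ℓ q (curvatureAt g (A q.proj) q.snd (B q.proj)) : VField I.tangent _) p ∧
      leviCivita G (horLift g X)
        (fun q ↦ ℓ q (curvatureAt g (A q.proj) q.snd (B q.proj))) p
      = ℓ p (covDerivCurvatureAt g (X p.proj) (A p.proj) p.snd (B p.proj)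
          + curvatureAt g (leviCivita g X A p.proj) p.snd (B p.proj)
          + curvatureAt g (A p.proj) p.snd (leviCivita g X B p.proj))
        + Θ (curvatureAt g (A p.proj) p.snd (B p.proj)) := by
  obtain ⟨W, hWs, hW⟩ := hg.exists_dualFrame p.proj
  let C (k : FIdx E) : VField I M := curvature g A (frame I p.proj k) B
  have hC (k) : SmoothNear (C k) p.proj :=
    hg.curvature_smoothNear hA (frame_smoothNear _ k) hB
  have hX' := (hg.horLift_smoothAt hX : SmoothAt _ p)
  have hcomp : ∀ᶠ z in 𝓝 p.proj, ∀ v : TangentSpace I z,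
      curvatureAt g (A z) v (B z) = ∑ k, g z v (W k z) • C k z := by
    filter_upwards [frameSet_mem_nhds (I := I) p.proj, hA.eventually, hB.eventually]
      with z hz hAz hBz v
    let Λ := (hg.curvature_tensorial₂ (extField_smoothNear (A z))
      (extField_smoothNear (B z))).toLinearMap le_rfl
    have e : curvatureAt g (A z) v (B z) = Λ v := rfl
    rw [e, ← sum_coframe_smul_frame hz v, map_sum]
    refine Finset.sum_congr rfl fun k _ ↦ ?_
    rw [map_smul, sum_coframe_smul_frame hz v, hW z hz]
    congr 1
    exact (hg.curvature_eq hAz (eventually_of_mem ((isOpen_frameSet p.proj).mem_nhds hz)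
      fun y hy ↦ frame_smoothAt hy k) hBz).symm
  let L (k : FIdx E) : VField I.tangent (TangentBundle I M) := fun q ↦ ℓ q (C k q.proj)
  have hL (k) : SmoothNear (L k) p := hℓ _ (hC k)
  have hgerm : GermEq (fun q : TangentBundle I M ↦
      ℓ q (curvatureAt g (A q.proj) q.snd (B q.proj)) : VField I.tangent _)
      (∑ k, hat g (W k) • L k) p := by
    filter_upwards [(tendsto_proj p).eventually hcomp] with q hq
    rw [hq, map_sum, Finset.sum_apply]
    exact Finset.sum_congr rfl fun k _ ↦ map_smul _ _ _
  have hs (k) : SmoothNear (hat g (W k) • L k) p :=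
    SmoothNear.smul (hg.hat_smoothNear (hWs k)) (hL k)
  refine ⟨(SmoothNear.sum fun k _ ↦ hs k).congr hgerm.symm, ?_⟩
  rw [leviCivita_congr (GermEq.refl _ p) hgerm,
    hG.leviCivita_sum_right _ hX' fun k _ ↦ (hs k).smoothAt,
    ← hg.sum_covDeriv_components hWs hW hX hA hB, hcomp.self_of_nhds p.snd, map_sum, map_sum,
    ← Finset.sum_add_distrib]
  refine Finset.sum_congr rfl fun k _ ↦ ?_
  rw [hG.leviCivita_smul_right (hg.hat_smoothAt (hWs k).smoothAt) hX' (hL k).smoothAt,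
    hg.dirDeriv_hat_horLift hX.smoothAt (hWs k).smoothAt, hΘ _ (hC k)]
  simp only [hat, map_add, map_smul, smul_add]
  change _ • ℓ p (C k p.proj) + _ = _
  abel

variable {a b c α : ℝ} (ha : 0 < a) (hα : α = a * (a + c) - b ^ 2) (hαpos : 0 < α)
include ha hα hαpos

lemma leviCivita_verLift_curvatureAt {X A B : VField I M} {p : TangentBundle I M}
    (hX : SmoothNear X p.proj) (hA : SmoothNear A p.proj) (hB : SmoothNear B p.proj) :
    SmoothNear (fun q : TangentBundle I M ↦
        verLiftLin q (curvatureAt g (A q.proj) q.snd (B q.proj)) : VField I.tangent _) p ∧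
      leviCivita (gNatural g a b c) (horLift g X)
        (fun q ↦ verLiftLin q (curvatureAt g (A q.proj) q.snd (B q.proj))) p
      = verLiftLin p (covDerivCurvatureAt g (X p.proj) (A p.proj) p.snd (B p.proj)
          + curvatureAt g (leviCivita g X A p.proj) p.snd (B p.proj)
          + curvatureAt g (A p.proj) p.snd (leviCivita g X B p.proj))
        + (hg.horLiftLin p (-(a ^ 2 / (2 * α)) •
            curvatureAt g (curvatureAt g (A p.proj) p.snd (B p.proj)) p.snd (X p.proj))
          + verLiftLin p ((a * b / (2 * α)) •
            curvatureAt g (curvatureAt g (A p.proj) p.snd (B p.proj)) p.snd (X p.proj))) := by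
  let Θ : TangentSpace I p.proj →ₗ[ℝ] TangentSpace I.tangent p :=
    { toFun := fun v ↦ hg.horLiftLin p (-(a ^ 2 / (2 * α)) • curvatureAt g v p.snd (X p.proj))
        + verLiftLin p ((a * b / (2 * α)) • curvatureAt g v p.snd (X p.proj))
      map_add' := fun u v ↦ by
        simp only [hg.curvatureAt_add_left, map_add, smul_add]
        abel
      map_smul' := fun r v ↦ by
        simp only [hg.curvatureAt_smul_left, map_smul, RingHom.id_apply]
        module }
  refine hg.leviCivita_lift_curvatureAt (hg.gNatural_isMetric ha (hα ▸ hαpos)) verLiftLin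
    (fun C hC ↦ hg.verLift_smoothNear hC) Θ (fun C hC ↦ ?_) hX hA hB
  refine (hg.leviCivita_horLift_verLift ha hα hαpos hX hC).trans ?_
  change hg.horLiftLin p _ + verLiftLin p _ = verLiftLin p _ + (hg.horLiftLin p _ + verLiftLin p _)
  rw [map_add (verLiftLin p)]
  abel

lemma leviCivita_horLift_curvatureAt {X A B : VField I M} {p : TangentBundle I M}
    (hX : SmoothNear X p.proj) (hA : SmoothNear A p.proj) (hB : SmoothNear B p.proj) :
    SmoothNear (fun q : TangentBundle I M ↦
        hg.horLiftLin q (curvatureAt g (A q.proj) q.snd (B q.proj)) : VField I.tangent _) p ∧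
      leviCivita (gNatural g a b c) (horLift g X)
        (fun q ↦ hg.horLiftLin q (curvatureAt g (A q.proj) q.snd (B q.proj))) p
      = hg.horLiftLin p (covDerivCurvatureAt g (X p.proj) (A p.proj) p.snd (B p.proj)
          + curvatureAt g (leviCivita g X A p.proj) p.snd (B p.proj)
          + curvatureAt g (A p.proj) p.snd (leviCivita g X B p.proj))
        + (hg.horLiftLin p (-(a * b / (2 * α)) •
            (curvatureAt g (X p.proj) p.snd (curvatureAt g (A p.proj) p.snd (B p.proj))
              + curvatureAt g (curvatureAt g (A p.proj) p.snd (B p.proj)) p.snd (X p.proj)))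
          + verLiftLin p ((b ^ 2 / α) •
              curvatureAt g (X p.proj) p.snd (curvatureAt g (A p.proj) p.snd (B p.proj))
            - (a * (a + c) / (2 * α)) •
              curvatureAt g (X p.proj) (curvatureAt g (A p.proj) p.snd (B p.proj)) p.snd)) := by
  let Θ : TangentSpace I p.proj →ₗ[ℝ] TangentSpace I.tangent p :=
    { toFun := fun v ↦ hg.horLiftLin p (-(a * b / (2 * α)) •
            (curvatureAt g (X p.proj) p.snd v + curvatureAt g v p.snd (X p.proj)))
        + verLiftLin p ((b ^ 2 / α) • curvatureAt g (X p.proj) p.snd v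
            - (a * (a + c) / (2 * α)) • curvatureAt g (X p.proj) v p.snd)
      map_add' := fun u v ↦ by
        simp only [hg.curvatureAt_add_left, hg.curvatureAt_add_mid, hg.curvatureAt_add_right,
          map_add, map_sub, map_smul]
        module
      map_smul' := fun r v ↦ by
        simp only [hg.curvatureAt_smul_left, hg.curvatureAt_smul_mid, hg.curvatureAt_smul_right,
          map_add, map_sub, map_smul, RingHom.id_apply]
        module }
  refine hg.leviCivita_lift_curvatureAt (hg.gNatural_isMetric ha (hα ▸ hαpos)) hg.horLiftLin
    (fun C hC ↦ hg.horLift_smoothNear hC) Θ (fun C hC ↦ ?_) hX hA hB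
  refine (hg.leviCivita_horLift_horLift ha hα hαpos hX hC).trans ?_
  change hg.horLiftLin p _ + verLiftLin p _
    = hg.horLiftLin p _ + (hg.horLiftLin p _ + verLiftLin p _)
  simp only [map_add, map_sub, map_smul]
  module

/-- The second covariant derivative of a vertical lift along horizontal lifts. -/
lemma leviCivita_horLift_leviCivita_horLift_verLift {X Y Z : VField I M} {p : TangentBundle I M}
    (hX : SmoothNear X p.proj) (hY : SmoothNear Y p.proj) (hZ : SmoothNear Z p.proj) :
    leviCivita (gNatural g a b c) (horLift g X)
        (leviCivita (gNatural g a b c) (horLift g Y) (verLift Z)) p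
      = hg.horLiftLin p (-(a ^ 2 / (2 * α)) • (
            curvatureAt g (leviCivita g Y Z p.proj) p.snd (X p.proj)
            + covDerivCurvatureAt g (X p.proj) (Z p.proj) p.snd (Y p.proj)
            + curvatureAt g (leviCivita g X Z p.proj) p.snd (Y p.proj)
            + curvatureAt g (Z p.proj) p.snd (leviCivita g X Y p.proj))
          + (a ^ 3 * b / (4 * α ^ 2)) •
            curvatureAt g (X p.proj) p.snd (curvatureAt g (Z p.proj) p.snd (Y p.proj)))
        + verLiftLin p (leviCivita g X (leviCivita g Y Z) p.proj
          + (a * b / (2 * α)) • (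
            curvatureAt g (leviCivita g Y Z p.proj) p.snd (X p.proj)
            + covDerivCurvatureAt g (X p.proj) (Z p.proj) p.snd (Y p.proj)
            + curvatureAt g (leviCivita g X Z p.proj) p.snd (Y p.proj)
            + curvatureAt g (Z p.proj) p.snd (leviCivita g X Y p.proj))
          + (a ^ 2 / (4 * α)) •
            curvatureAt g (X p.proj) (curvatureAt g (Z p.proj) p.snd (Y p.proj)) p.snd
          - (a ^ 2 * b ^ 2 / (4 * α ^ 2)) •
            curvatureAt g (X p.proj) p.snd (curvatureAt g (Z p.proj) p.snd (Y p.proj))) := by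
  have hG := hg.gNatural_isMetric ha (hα ▸ hαpos)
  obtain ⟨hvs, hv⟩ := hg.leviCivita_verLift_curvatureAt ha hα hαpos hX hZ hY
  obtain ⟨hhs, hh⟩ := hg.leviCivita_horLift_curvatureAt ha hα hαpos hX hZ hY
  set VT : VField I.tangent (TangentBundle I M) :=
    fun q ↦ verLiftLin q (curvatureAt g (Z q.proj) q.snd (Y q.proj)) with hVT
  set HT : VField I.tangent (TangentBundle I M) :=
    fun q ↦ hg.horLiftLin q (curvatureAt g (Z q.proj) q.snd (Y q.proj)) with hHT
  have hYZ := hg.leviCivita_smoothNear hY hZ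
  have hX' := (hg.horLift_smoothAt hX : SmoothAt _ p)
  have hYZ' := (hg.verLift_smoothAt hYZ : SmoothAt _ p)
  have hgerm : GermEq (leviCivita (gNatural g a b c) (horLift g Y) (verLift Z))
      (verLift (leviCivita g Y Z) + ((-(a ^ 2 / (2 * α))) • HT + (a * b / (2 * α)) • VT)) p := by
    filter_upwards [(tendsto_proj p).eventually hY.eventually,
      (tendsto_proj p).eventually hZ.eventually] with q hYq hZq
    refine (hg.leviCivita_horLift_verLift ha hα hαpos hYq hZq).trans ?_
    change hg.horLiftLin q _ + verLiftLin q _ = verLiftLin q _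
      + ((_ : ℝ) • hg.horLiftLin q _ + (_ : ℝ) • verLiftLin q _)
    rw [map_add (verLiftLin q), map_smul, map_smul]
    abel
  rw [leviCivita_congr (GermEq.refl _ p) hgerm,
    hG.leviCivita_add_right hX' hYZ' ((hhs.smoothAt.const_smul _).add (hvs.smoothAt.const_smul _)),
    hG.leviCivita_add_right hX' (hhs.smoothAt.const_smul _) (hvs.smoothAt.const_smul _),
    hG.leviCivita_const_smul_right _ hX' hhs.smoothAt,
    hG.leviCivita_const_smul_right _ hX' hvs.smoothAt, hh, hv,
    hg.leviCivita_horLift_verLift ha hα hαpos hX hYZ]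
  change hg.horLiftLin p _ + verLiftLin p _ + _ = _
  have hB : curvatureAt g (curvatureAt g (Z p.proj) p.snd (Y p.proj)) p.snd (X p.proj)
      = curvatureAt g (X p.proj) p.snd (curvatureAt g (Z p.proj) p.snd (Y p.proj))
        - curvatureAt g (X p.proj) (curvatureAt g (Z p.proj) p.snd (Y p.proj)) p.snd := by
    have h1 := hg.bianchi p.proj (X p.proj) (curvatureAt g (Z p.proj) p.snd (Y p.proj)) p.snd
    rw [hg.curvatureAt_swap p.proj p.snd (X p.proj)] at h1
    linear_combination (norm := module) h1
  have hα0 := hαpos.ne'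
  have hac : a * (a + c) / (2 * α) = 1 / 2 + b ^ 2 / (2 * α) := by
    rw [show a * (a + c) = α + b ^ 2 by rw [hα]; ring]
    field_simp
  rw [hB, hac]
  simp only [map_add, map_sub, map_smul]
  match_scalars <;> field_simp <;> ring

/-- The curvature of a `g`-natural metric on two horizontal lifts and a vertical lift. -/
theorem curvature_gNatural_horLift_horLift_verLift {X Y Z : VField I M} {p : TangentBundle I M}
    (hX : SmoothNear X p.proj) (hY : SmoothNear Y p.proj) (hZ : SmoothNear Z p.proj) :
    curvature (gNatural g a b c) (horLift g X) (horLift g Y) (verLift Z) p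
      = hg.horLiftLin p
          ((a ^ 2 / (2 * α)) •
              (covDerivCurvatureAt g (Y p.proj) (Z p.proj) p.snd (X p.proj)
                - covDerivCurvatureAt g (X p.proj) (Z p.proj) p.snd (Y p.proj))
            + (a ^ 3 * b / (4 * α ^ 2)) •
              (curvatureAt g (X p.proj) p.snd (curvatureAt g (Z p.proj) p.snd (Y p.proj))
                - curvatureAt g (Y p.proj) p.snd (curvatureAt g (Z p.proj) p.snd (X p.proj))))
        + verLiftLin p
          (curvatureAt g (X p.proj) (Y p.proj) (Z p.proj)
            + (a * b / (2 * α)) •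
              (covDerivCurvatureAt g (X p.proj) (Z p.proj) p.snd (Y p.proj)
                - covDerivCurvatureAt g (Y p.proj) (Z p.proj) p.snd (X p.proj))
            + (a ^ 2 / (4 * α)) •
              (curvatureAt g (X p.proj) (curvatureAt g (Z p.proj) p.snd (Y p.proj)) p.snd
                - curvatureAt g (Y p.proj) (curvatureAt g (Z p.proj) p.snd (X p.proj)) p.snd)
            + (a ^ 2 * b ^ 2 / (4 * α ^ 2)) •
              (curvatureAt g (Y p.proj) p.snd (curvatureAt g (Z p.proj) p.snd (X p.proj))
                - curvatureAt g (X p.proj) p.snd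
                  (curvatureAt g (Z p.proj) p.snd (Y p.proj)))) := by
  have hG := hg.gNatural_isMetric ha (hα ▸ hαpos)
  have hXY := hX.mlieBracket hY
  have hXY' := (hg.horLift_smoothAt hXY : SmoothAt _ p)
  have hZ' := (hg.verLift_smoothAt hZ : SmoothAt _ p)
  set ρ := curvatureAt g (X p.proj) (Y p.proj) p.snd with hρ
  have hV := extField_smoothNear ρ
  have hV' := (hg.verLift_smoothAt hV : SmoothAt _ p)
  have hbr : leviCivita (gNatural g a b c)
      (mlieBracket I.tangent (horLift g X) (horLift g Y)) (verLift Z) p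
      = hg.horLiftLin p (-(a ^ 2 / (2 * α)) •
          curvatureAt g (Z p.proj) p.snd (mlieBracket I X Y p.proj))
        + verLiftLin p (leviCivita g (mlieBracket I X Y) Z p.proj
          + (a * b / (2 * α)) • curvatureAt g (Z p.proj) p.snd (mlieBracket I X Y p.proj)) := by
    rw [hG.leviCivita_pointwise (X' := horLift g (mlieBracket I X Y) - verLift (extField ρ))
      ((hg.horLift_smoothAt hX).mlieBracket (hg.horLift_smoothAt hY)) (hXY'.sub hV') hZ',
      hG.leviCivita_sub_left hXY' hV' hZ', hg.leviCivita_verLift_verLift ha hα hαpos hV hZ,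
      sub_zero, hg.leviCivita_horLift_verLift ha hα hαpos hXY hZ]
    · rfl
    · rw [hg.mlieBracket_horLift_horLift hX hY, Pi.sub_apply, verLift, extField_self]
      rfl
  have hT : curvatureAt g (Z p.proj) p.snd (mlieBracket I X Y p.proj)
      = curvatureAt g (Z p.proj) p.snd (leviCivita g X Y p.proj)
        - curvatureAt g (Z p.proj) p.snd (leviCivita g Y X p.proj) := by
    rw [hg.torsion_free hX.smoothAt hY.smoothAt, sub_eq_add_neg, ← neg_one_smul ℝ,
      hg.curvatureAt_add_right, hg.curvatureAt_smul_right]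
    module
  have hR : leviCivita g X (leviCivita g Y Z) p.proj
      = curvatureAt g (X p.proj) (Y p.proj) (Z p.proj) + leviCivita g Y (leviCivita g X Z) p.proj
        + leviCivita g (mlieBracket I X Y) Z p.proj := by
    rw [← hg.curvature_eq hX hY hZ, curvature_apply]
    abel
  rw [curvature_apply, hg.leviCivita_horLift_leviCivita_horLift_verLift ha hα hαpos hX hY hZ,
    hg.leviCivita_horLift_leviCivita_horLift_verLift ha hα hαpos hY hX hZ, hbr, hT, hR]
  simp only [map_add, map_sub, map_smul]
  module

end IsMetric

end LiftCurvature

end GNat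

end

theorem stmt_3 {n : ℕ} (hn : 3 ≤ n) {M : Type*} [TopologicalSpace M]
    [ChartedSpace (EuclideanSpace ℝ (Fin n)) M] [IsManifold (𝓡 n) ∞ M]
    (g : GNat.MetricField (𝓡 n) M) (hg : GNat.IsRiemannianMetric g)
    (a b c α : ℝ) (ha : 0 < a) (hα : α = a * (a + c) - b ^ 2) (hαpos : 0 < α)
    (X Y Z : GNat.VField (𝓡 n) M)
    (hX : GNat.Smooth X) (hY : GNat.Smooth Y) (hZ : GNat.Smooth Z)
    (x : M) (t : TangentSpace (𝓡 n) x) :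
    GNat.curvature (GNat.gNatural g a b c)
        (GNat.horLift g X) (GNat.horLift g Y) (GNat.verLift Z) ⟨x, t⟩
      = GNat.horLiftAt g ⟨x, t⟩
          ((a ^ 2 / (2 * α)) •
              (GNat.covDerivCurvatureAt g (Y x) (Z x) t (X x)
                - GNat.covDerivCurvatureAt g (X x) (Z x) t (Y x))
            + (a ^ 3 * b / (4 * α ^ 2)) •
              (GNat.curvatureAt g (X x) t (GNat.curvatureAt g (Z x) t (Y x))
                - GNat.curvatureAt g (Y x) t (GNat.curvatureAt g (Z x) t (X x))))
        + GNat.verLiftAt ⟨x, t⟩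
          (GNat.curvatureAt g (X x) (Y x) (Z x)
            + (a * b / (2 * α)) •
              (GNat.covDerivCurvatureAt g (X x) (Z x) t (Y x)
                - GNat.covDerivCurvatureAt g (Y x) (Z x) t (X x))
            + (a ^ 2 / (4 * α)) •
              (GNat.curvatureAt g (X x) (GNat.curvatureAt g (Z x) t (Y x)) t
                - GNat.curvatureAt g (Y x) (GNat.curvatureAt g (Z x) t (X x)) t)
            + (a ^ 2 * b ^ 2 / (4 * α ^ 2)) •
              (GNat.curvatureAt g (Y x) t (GNat.curvatureAt g (Z x) t (X x))
                - GNat.curvatureAt g (X x) t (GNat.curvatureAt g (Z x) t (Y x)))) := by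
  have : Nontrivial (EuclideanSpace ℝ (Fin n)) :=
    have : NeZero n := ⟨by omega⟩
    inferInstance
  exact hg.isMetric.curvature_gNatural_horLift_horLift_verLift ha hα hαpos
    (p := (⟨x, t⟩ : TangentBundle (𝓡 n) M)) (hX.smoothNear x) (hY.smoothNear x) (hZ.smoothNear x)
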